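/- arXiv:1706.00075 — 2 statements merged into one kernel-verified Lean document; each statement's English description precedes it below -/
import Mathlib

section
/- Let ε ∈ ℤ/p²ℤ be an element whose reduction modulo p is not a square in ℤ/pℤ. Let H be a subgroup of GL₂(ℤ/p²ℤ) contained in ker φ, all of whose elements have determinant 1, and suppose H has order p². Then H is conjugate in GL₂(ℤ/p²ℤ) to one of the following three subgroups: H₁ generated by 1 + p·!![1,0;0,-1] and 1 + p·!![0,1;0,0]; H₂ generated by 1 + p·!![1,0;0,-1] and 1 + p·!![0,1;1,0]; H₃ generated by 1 + p·!![1,0;0,-1] and 1 + p·!![0,ε;1,0]. Moreover, no two distinct subgroups among H₁, H₂, H₃ are locally conjugate in GL₂(ℤ/p²ℤ). -/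
open Matrix

/-- `GL₂(ℤ/nℤ)`. -/
abbrev GL2 (n : ℕ) : Type := GL (Fin 2) (ZMod n)

/-- Reduction modulo `p` from `ℤ/p²ℤ` to `ℤ/pℤ`. -/
def red (p : ℕ) : ZMod (p^2) →+* ZMod p :=
  ZMod.castHom (dvd_pow_self p (by norm_num)) (ZMod p)

/-- The natural homomorphism `φ : GL₂(ℤ/p²ℤ) →* GL₂(ℤ/pℤ)` given by entrywise
reduction modulo `p`. -/
def phi (p : ℕ) : GL2 (p^2) →* GL2 p :=
  Matrix.GeneralLinearGroup.map (red p)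

/-- The element `1 + p • A` of `GL₂(ℤ/p²ℤ)` (its inverse is `1 - p • A`). -/
def kerUnit {p : ℕ} (A : Matrix (Fin 2) (Fin 2) (ZMod (p^2))) : GL2 (p^2) where
  val := 1 + (p : ZMod (p^2)) • A
  inv := 1 - (p : ZMod (p^2)) • A
  val_inv := by
    have h : ((p : ZMod (p^2)) • A) * ((p : ZMod (p^2)) • A) = 0 := by
      rw [smul_mul_assoc, mul_smul_comm, smul_smul, ← Nat.cast_mul, ← pow_two,
        ZMod.natCast_self, zero_smul]
    rw [add_mul, one_mul, mul_sub, mul_one, h, sub_zero]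
    abel
  inv_val := by
    have h : ((p : ZMod (p^2)) • A) * ((p : ZMod (p^2)) • A) = 0 := by
      rw [smul_mul_assoc, mul_smul_comm, smul_smul, ← Nat.cast_mul, ← pow_two,
        ZMod.natCast_self, zero_smul]
    rw [sub_mul, one_mul, mul_add, mul_one, h, add_zero]
    abel

/-- The antidiagonal swap matrix `!![0,1;1,0]` as an element of `GL₂(ℤ/p²ℤ)`. -/
def swapGL (p : ℕ) : GL2 (p^2) where
  val := !![0, 1; 1, 0]
  inv := !![0, 1; 1, 0]
  val_inv := by
    ext i j
    fin_cases i <;> fin_cases j <;>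
      simp [Matrix.mul_apply, Fin.sum_univ_succ, Matrix.one_apply]
  inv_val := by
    ext i j
    fin_cases i <;> fin_cases j <;>
      simp [Matrix.mul_apply, Fin.sum_univ_succ, Matrix.one_apply]

/-- Subgroups `H₁` and `H₂` of a group `G` are locally conjugate in `G` if there is a
bijection `f : H₁ → H₂` such that `h` and `f h` are conjugate in `G` for every `h ∈ H₁`. -/
def IsLocallyConjugate {G : Type*} [Group G] (H₁ H₂ : Subgroup G) : Prop :=
  ∃ f : H₁ ≃ H₂, ∀ h : H₁, IsConj (h : G) ((f h : G))

/-- Subgroups `H₁` and `H₂` of `G` are conjugate in `G`: `g H₁ g⁻¹ = H₂` for some `g`. -/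
def IsConjugateSubgroup {G : Type*} [Group G] (H₁ H₂ : Subgroup G) : Prop :=
  ∃ g : G, Subgroup.map (MulAut.conj g).toMonoidHom H₁ = H₂

/-- Nontrivially locally conjugate: locally conjugate but not conjugate. -/
def IsNontriviallyLocallyConjugate {G : Type*} [Group G] (H₁ H₂ : Subgroup G) : Prop :=
  IsLocallyConjugate H₁ H₂ ∧ ¬ IsConjugateSubgroup H₁ H₂

/-- The subgroup `H₁` of Lemma 4.9 (`lemmaT2`). -/
def T₁ (p : ℕ) : Subgroup (GL2 (p^2)) :=
  Subgroup.closure {kerUnit !![1, 0; 0, -1], kerUnit !![0, 1; 0, 0]}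

/-- The subgroup `H₂` of Lemma 4.9 (`lemmaT2`). -/
def T₂ (p : ℕ) : Subgroup (GL2 (p^2)) :=
  Subgroup.closure {kerUnit !![1, 0; 0, -1], kerUnit !![0, 1; 1, 0]}

/-- The subgroup `H₃` of Lemma 4.9 (`lemmaT2`). -/
def T₃ (p : ℕ) (ε : ZMod (p^2)) : Subgroup (GL2 (p^2)) :=
  Subgroup.closure {kerUnit !![1, 0; 0, -1], kerUnit !![0, ε; 1, 0]}

theorem red_surjective (p : ℕ) [Fact p.Prime] : Function.Surjective (red p) :=
  ZMod.castHom_surjective _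

theorem natCast_mul_eq_zero_iff {p : ℕ} [hp : Fact p.Prime] (x : ZMod (p ^ 2)) :
    (p : ZMod (p ^ 2)) * x = 0 ↔ red p x = 0 := by
  obtain ⟨n, rfl⟩ := ZMod.natCast_zmod_surjective x
  rw [map_natCast, ← Nat.cast_mul, ZMod.natCast_eq_zero_iff, ZMod.natCast_eq_zero_iff, pow_two,
    Nat.mul_dvd_mul_iff_left hp.out.pos]

theorem natCast_mul_eq_iff {p : ℕ} [Fact p.Prime] (x y : ZMod (p ^ 2)) :
    (p : ZMod (p ^ 2)) * x = (p : ZMod (p ^ 2)) * y ↔ red p x = red p y := by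
  rw [← sub_eq_zero, ← mul_sub, natCast_mul_eq_zero_iff, map_sub, sub_eq_zero]

theorem exists_eq_natCast_mul {p : ℕ} [Fact p.Prime] {x : ZMod (p ^ 2)} (hx : red p x = 0) :
    ∃ y, x = p * y := by
  obtain ⟨n, rfl⟩ := ZMod.natCast_zmod_surjective x
  rw [map_natCast, ZMod.natCast_eq_zero_iff] at hx
  obtain ⟨m, rfl⟩ := hx
  exact ⟨m, by push_cast; rfl⟩

theorem isUnit_of_red_ne_zero {p : ℕ} [hp : Fact p.Prime] {x : ZMod (p ^ 2)}
    (hx : red p x ≠ 0) : IsUnit x := by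
  obtain ⟨n, rfl⟩ := ZMod.natCast_zmod_surjective x
  rw [map_natCast, Ne, ZMod.natCast_eq_zero_iff] at hx
  rw [ZMod.isUnit_iff_coprime]
  exact ((hp.out.coprime_iff_not_dvd.2 hx).symm).pow_right 2

theorem phi_surjective (p : ℕ) [Fact p.Prime] : Function.Surjective (phi p) := by
  intro P
  choose f hf using red_surjective p
  set A : Matrix (Fin 2) (Fin 2) (ZMod (p ^ 2)) := P.val.map f with hA
  have hmap : A.map (red p) = P.val := by
    ext i j
    simp [hA, hf]
  have hdet : red p A.det = P.val.det := by
    rw [RingHom.map_det, RingHom.mapMatrix_apply, hmap]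
  have hu : IsUnit A.det := isUnit_of_red_ne_zero <| by
    rw [hdet]
    exact ((Matrix.isUnit_iff_isUnit_det _).1 P.isUnit).ne_zero
  refine ⟨Matrix.GeneralLinearGroup.mk'' A hu, Units.ext ?_⟩
  exact hmap

theorem kerUnit_eq_iff {p : ℕ} [Fact p.Prime] (A B : Matrix (Fin 2) (Fin 2) (ZMod (p ^ 2))) :
    kerUnit A = kerUnit B ↔ A.map (red p) = B.map (red p) := by
  rw [Units.ext_iff]
  simp only [kerUnit, add_right_inj, ← Matrix.ext_iff, Matrix.smul_apply, smul_eq_mul,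
    natCast_mul_eq_iff, Matrix.map_apply]

theorem kerUnit_add {p : ℕ} (A B : Matrix (Fin 2) (Fin 2) (ZMod (p ^ 2))) :
    kerUnit (A + B) = kerUnit A * kerUnit B := by
  have h : ((p : ZMod (p ^ 2)) • A) * ((p : ZMod (p ^ 2)) • B) = 0 := by
    rw [smul_mul_assoc, mul_smul_comm, smul_smul, ← Nat.cast_mul, ← pow_two,
      ZMod.natCast_self, zero_smul]
  apply Units.ext
  simp only [kerUnit, Units.val_mul, add_mul, mul_add, h, one_mul, mul_one, smul_add, add_zero]
  abel

theorem conj_kerUnit {p : ℕ} (g : GL2 (p ^ 2)) (A : Matrix (Fin 2) (Fin 2) (ZMod (p ^ 2))) :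
    g * kerUnit A * g⁻¹ = kerUnit (g.val * A * g⁻¹.val) := by
  apply Units.ext
  simp [kerUnit, mul_add, add_mul]

/-- The homomorphism `A ↦ 1 + p A` from matrices over `ℤ/pℤ` to `GL₂(ℤ/p²ℤ)`. -/
def kerHom (p : ℕ) [Fact p.Prime] :
    Multiplicative (Matrix (Fin 2) (Fin 2) (ZMod p)) →* GL2 (p ^ 2) :=
  MonoidHom.mk' (fun A => kerUnit (A.toAdd.map fun x => (x.val : ZMod (p ^ 2)))) <| by
    intro A B
    rw [← kerUnit_add, kerUnit_eq_iff]
    ext i j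
    simp

/-- The element `1 + p A` of `GL₂(ℤ/p²ℤ)` for a matrix `A` over `ℤ/pℤ`. -/
def kerElt {p : ℕ} [Fact p.Prime] (A : Matrix (Fin 2) (Fin 2) (ZMod p)) : GL2 (p ^ 2) :=
  kerHom p (Multiplicative.ofAdd A)

section kerElt

variable {p : ℕ} [Fact p.Prime]

theorem kerUnit_eq_kerElt (A : Matrix (Fin 2) (Fin 2) (ZMod (p ^ 2))) :
    kerUnit A = kerElt (A.map (red p)) := by
  change _ = kerUnit _
  rw [kerUnit_eq_iff]
  ext i j
  simp

theorem exists_kerElt_eq_kerUnit (A : Matrix (Fin 2) (Fin 2) (ZMod p)) :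
    ∃ B : Matrix (Fin 2) (Fin 2) (ZMod (p ^ 2)), kerElt A = kerUnit B ∧ B.map (red p) = A := by
  refine ⟨A.map fun x => (x.val : ZMod (p ^ 2)), rfl, ?_⟩
  ext i j
  simp

theorem kerElt_injective : Function.Injective (kerElt (p := p)) := by
  intro A B h
  obtain ⟨A', hA, rfl⟩ := exists_kerElt_eq_kerUnit A
  obtain ⟨B', hB, rfl⟩ := exists_kerElt_eq_kerUnit B
  rwa [hA, hB, kerUnit_eq_iff] at h

theorem kerElt_zero : kerElt (0 : Matrix (Fin 2) (Fin 2) (ZMod p)) = 1 :=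
  map_one (kerHom p)

theorem kerElt_add (A B : Matrix (Fin 2) (Fin 2) (ZMod p)) :
    kerElt (A + B) = kerElt A * kerElt B :=
  map_mul (kerHom p) _ _

theorem kerElt_neg (A : Matrix (Fin 2) (Fin 2) (ZMod p)) : kerElt (-A) = (kerElt A)⁻¹ :=
  map_inv (kerHom p) _

theorem kerElt_smul (s : ZMod p) (A : Matrix (Fin 2) (Fin 2) (ZMod p)) :
    kerElt (s • A) = kerElt A ^ s.val := by
  have h : s • A = s.val • A := by
    rw [← Nat.cast_smul_eq_nsmul (ZMod p), ZMod.natCast_zmod_val]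
  rw [h]
  exact map_pow (kerHom p) (Multiplicative.ofAdd A) s.val

theorem conj_kerElt (g : GL2 (p ^ 2)) (A : Matrix (Fin 2) (Fin 2) (ZMod p)) :
    g * kerElt A * g⁻¹ = kerElt ((phi p g).val * A * (phi p g)⁻¹.val) := by
  obtain ⟨A', hA, rfl⟩ := exists_kerElt_eq_kerUnit A
  rw [hA, conj_kerUnit, kerUnit_eq_kerElt, ← map_inv, Matrix.map_mul, Matrix.map_mul]
  rfl

theorem det_eq_of_isConj_kerElt {A B : Matrix (Fin 2) (Fin 2) (ZMod p)}
    (h : IsConj (kerElt A) (kerElt B)) : A.det = B.det := by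
  obtain ⟨g, hg⟩ := isConj_iff.1 h
  rw [conj_kerElt] at hg
  rw [← kerElt_injective hg, Matrix.coe_units_inv]
  exact (Matrix.det_conj (phi p g).isUnit A).symm

theorem mem_closure_kerElt_pair {A B : Matrix (Fin 2) (Fin 2) (ZMod p)} {g : GL2 (p ^ 2)} :
    g ∈ Subgroup.closure {kerElt A, kerElt B} ↔ ∃ s t : ZMod p, g = kerElt (s • A + t • B) := by
  constructor
  · intro h
    induction h using Subgroup.closure_induction with
    | mem x hx =>
      rcases hx with rfl | rfl
      · exact ⟨1, 0, by simp⟩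
      · exact ⟨0, 1, by simp⟩
    | one => exact ⟨0, 0, by simp [kerElt_zero]⟩
    | mul x y _ _ hx hy =>
      obtain ⟨s, t, rfl⟩ := hx
      obtain ⟨s', t', rfl⟩ := hy
      refine ⟨s + s', t + t', ?_⟩
      rw [← kerElt_add]
      congr 1
      module
    | inv x _ hx =>
      obtain ⟨s, t, rfl⟩ := hx
      refine ⟨-s, -t, ?_⟩
      rw [← kerElt_neg]
      congr 1
      module
  · rintro ⟨s, t, rfl⟩
    rw [kerElt_add, kerElt_smul, kerElt_smul]
    exact mul_mem (pow_mem (Subgroup.subset_closure (by simp)) _)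
      (pow_mem (Subgroup.subset_closure (by simp)) _)

theorem card_closure_kerElt_pair_le (A B : Matrix (Fin 2) (Fin 2) (ZMod p)) :
    Nat.card (Subgroup.closure {kerElt A, kerElt B}) ≤ p ^ 2 := by
  have hsurj : Function.Surjective (fun x : ZMod p × ZMod p =>
      (⟨kerElt (x.1 • A + x.2 • B), mem_closure_kerElt_pair.2 ⟨x.1, x.2, rfl⟩⟩ :
        Subgroup.closure {kerElt A, kerElt B})) := by
    rintro ⟨g, hg⟩
    obtain ⟨s, t, rfl⟩ := mem_closure_kerElt_pair.1 hg
    exact ⟨(s, t), rfl⟩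
  refine (Nat.card_le_card_of_surjective _ hsurj).trans ?_
  rw [Nat.card_prod, Nat.card_zmod, pow_two]

theorem mem_closure_kerUnit_pair {b c : ZMod (p ^ 2)} {g : GL2 (p ^ 2)} :
    g ∈ Subgroup.closure {kerUnit !![1, 0; 0, -1], kerUnit !![0, b; c, 0]} ↔
      ∃ s t : ZMod p, g = kerElt !![s, t * red p b; t * red p c, -s] := by
  rw [kerUnit_eq_kerElt, kerUnit_eq_kerElt, mem_closure_kerElt_pair]
  refine exists₂_congr fun s t => ?_
  congr! 2
  ext i j
  fin_cases i <;> fin_cases j <;> simp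

theorem mem_T₁ {g : GL2 (p ^ 2)} : g ∈ T₁ p ↔ ∃ s t : ZMod p, g = kerElt !![s, t; 0, -s] := by
  rw [T₁]
  simpa using mem_closure_kerUnit_pair (p := p) (b := 1) (c := 0) (g := g)

theorem mem_T₂ {g : GL2 (p ^ 2)} : g ∈ T₂ p ↔ ∃ s t : ZMod p, g = kerElt !![s, t; t, -s] := by
  rw [T₂]
  simpa using mem_closure_kerUnit_pair (p := p) (b := 1) (c := 1) (g := g)

theorem mem_T₃ {ε : ZMod (p ^ 2)} {g : GL2 (p ^ 2)} :
    g ∈ T₃ p ε ↔ ∃ s t : ZMod p, g = kerElt !![s, t * red p ε; t, -s] := by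
  rw [T₃]
  simpa using mem_closure_kerUnit_pair (p := p) (b := ε) (c := 1) (g := g)

theorem card_closure_kerUnit_pair_le (A B : Matrix (Fin 2) (Fin 2) (ZMod (p ^ 2))) :
    Nat.card (Subgroup.closure {kerUnit A, kerUnit B}) ≤ p ^ 2 := by
  rw [kerUnit_eq_kerElt, kerUnit_eq_kerElt]
  exact card_closure_kerElt_pair_le _ _

theorem exists_eq_kerElt_of_mem_ker {g : GL2 (p ^ 2)} (hg : g ∈ (phi p).ker) :
    ∃ A, g = kerElt A := by
  have h : ∀ i j, red p (g.val i j - (1 : Matrix (Fin 2) (Fin 2) (ZMod (p ^ 2))) i j) = 0 := by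
    intro i j
    have h1 := congrArg (fun P : GL2 p => P.val i j) ((MonoidHom.mem_ker).1 hg)
    have h2 : red p (g.val i j) = (1 : Matrix (Fin 2) (Fin 2) (ZMod p)) i j := h1
    rw [map_sub, h2, Matrix.one_apply, Matrix.one_apply]
    split_ifs <;> simp
  choose f hf using fun i j => exists_eq_natCast_mul (h i j)
  refine ⟨(Matrix.of f).map (red p), ?_⟩
  rw [← kerUnit_eq_kerElt]
  ext i j
  simp [kerUnit, ← hf]

theorem trace_eq_zero_of_det_kerElt {A : Matrix (Fin 2) (Fin 2) (ZMod p)}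
    (h : (kerElt A).val.det = 1) : A.trace = 0 := by
  obtain ⟨B, hB, rfl⟩ := exists_kerElt_eq_kerUnit A
  have hpp : (p : ZMod (p ^ 2)) * p = 0 := by
    rw [← Nat.cast_mul, ← pow_two, ZMod.natCast_self]
  rw [hB, Matrix.det_fin_two] at h
  simp only [kerUnit, Matrix.add_apply, Matrix.smul_apply, smul_eq_mul, Matrix.one_apply_eq, ne_eq,
    zero_ne_one, one_ne_zero, not_false_eq_true, Matrix.one_apply_ne, zero_add] at h
  rw [Matrix.trace_fin_two, Matrix.map_apply, Matrix.map_apply, ← map_add,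
    ← natCast_mul_eq_zero_iff]
  linear_combination h - (B 0 0 * B 1 1 - B 0 1 * B 1 0) * hpp

end kerElt

section LocallyConjugate

theorem IsLocallyConjugate.symm {G : Type*} [Group G] {H K : Subgroup G}
    (h : IsLocallyConjugate H K) : IsLocallyConjugate K H := by
  obtain ⟨f, hf⟩ := h
  exact ⟨f.symm, fun k => by simpa using (hf (f.symm k)).symm⟩

theorem IsLocallyConjugate.exists_isConj {G : Type*} [Group G] {H K : Subgroup G}
    (h : IsLocallyConjugate H K) {x : G} (hx : x ∈ H) : ∃ y ∈ K, IsConj x y := by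
  obtain ⟨f, hf⟩ := h
  exact ⟨f ⟨x, hx⟩, (f ⟨x, hx⟩).2, hf ⟨x, hx⟩⟩

variable {p : ℕ} [Fact p.Prime]

theorem not_isLocallyConjugate_T₁_T₂ {e : ZMod p} (he : ¬ IsSquare e) :
    ¬ IsLocallyConjugate (T₁ p) (T₂ p) := by
  intro h
  obtain ⟨s, t, hst⟩ := ZMod.sq_add_sq p e
  obtain ⟨y, hy, hconj⟩ := h.symm.exists_isConj (mem_T₂.2 ⟨s, t, rfl⟩)
  obtain ⟨a, b, rfl⟩ := mem_T₁.1 hy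
  have hdet := det_eq_of_isConj_kerElt hconj
  simp only [Matrix.det_fin_two_of] at hdet
  exact he ⟨a, by linear_combination -hdet - hst⟩

theorem not_isLocallyConjugate_T₁_T₃ {ε : ZMod (p ^ 2)} (hε : ¬ IsSquare (red p ε)) :
    ¬ IsLocallyConjugate (T₁ p) (T₃ p ε) := by
  intro h
  obtain ⟨y, hy, hconj⟩ := h.symm.exists_isConj (mem_T₃.2 ⟨0, 1, rfl⟩)
  obtain ⟨a, b, rfl⟩ := mem_T₁.1 hy
  have hdet := det_eq_of_isConj_kerElt hconj
  simp only [Matrix.det_fin_two_of] at hdet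
  exact hε ⟨a, by linear_combination -hdet⟩

theorem isSquare_mul_of_not_isSquare {a b : ZMod p} (ha : ¬ IsSquare a) (hb : ¬ IsSquare b) :
    IsSquare (a * b) := by
  have ha0 : a ≠ 0 := fun h => ha (h ▸ IsSquare.zero)
  have hb0 : b ≠ 0 := fun h => hb (h ▸ IsSquare.zero)
  have hF : ringChar (ZMod p) ≠ 2 := fun h => ha (FiniteField.isSquare_of_char_two h a)
  rw [← quadraticChar_one_iff_isSquare (mul_ne_zero ha0 hb0), map_mul,
    quadraticChar_neg_one_iff_not_isSquare.2 ha, quadraticChar_neg_one_iff_not_isSquare.2 hb]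
  norm_num

theorem eq_zero_of_sq_eq_mul_sq {F : Type*} [Field F] {a b d : F} (hd : ¬ IsSquare d)
    (h : a ^ 2 = d * b ^ 2) : a = 0 ∧ b = 0 := by
  have hb : b = 0 := by
    by_contra hb
    exact hd ⟨a / b, by field_simp; exact h.symm⟩
  subst hb
  simpa using h

theorem not_isLocallyConjugate_T₂_T₃ {ε : ZMod (p ^ 2)} (hε : ¬ IsSquare (red p ε)) :
    ¬ IsLocallyConjugate (T₂ p) (T₃ p ε) := by
  intro h
  by_cases hi : IsSquare (-1 : ZMod p)
  · obtain ⟨i, hi'⟩ := hi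
    obtain ⟨y, hy, hconj⟩ := h.exists_isConj (mem_T₂.2 ⟨1, i, rfl⟩)
    obtain ⟨a, b, rfl⟩ := mem_T₃.1 hy
    have hdet := det_eq_of_isConj_kerElt hconj
    simp only [Matrix.det_fin_two_of] at hdet
    have hne : ¬ IsSquare (-red p ε) := fun ⟨r, hr⟩ =>
      hε ⟨i * r, by linear_combination r * r * hi' - hr⟩
    obtain ⟨rfl, rfl⟩ := eq_zero_of_sq_eq_mul_sq (a := a) (b := b) hne
      (by linear_combination hdet - hi')
    have h0 : (!![(0 : ZMod p), 0 * red p ε; 0, -0]) = 0 := by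
      ext i j
      fin_cases i <;> fin_cases j <;> simp
    rw [h0, kerElt_zero, isConj_one_left, ← kerElt_zero] at hconj
    exact one_ne_zero (congrFun₂ (kerElt_injective hconj) 0 0)
  · obtain ⟨w, hw⟩ := isSquare_mul_of_not_isSquare hi hε
    obtain ⟨y, hy, hconj⟩ := h.symm.exists_isConj (mem_T₃.2 ⟨w, 1, rfl⟩)
    obtain ⟨a, b, rfl⟩ := mem_T₂.1 hy
    have hdet := det_eq_of_isConj_kerElt hconj
    simp only [Matrix.det_fin_two_of] at hdet
    obtain ⟨rfl, rfl⟩ := eq_zero_of_sq_eq_mul_sq (a := a) (b := b) hi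
      (by linear_combination hdet - hw)
    have h0 : (!![(0 : ZMod p), 0; 0, -0]) = 0 := by
      ext i j
      fin_cases i <;> fin_cases j <;> simp
    rw [h0, kerElt_zero, isConj_one_left, ← kerElt_zero] at hconj
    exact one_ne_zero (congrFun₂ (kerElt_injective hconj) 1 0)

end LocallyConjugate

section Classification

theorem exists_conj_companion {F : Type*} [Field F] (h2 : (2 : F) ≠ 0) {x y z : F}
    (h : x ≠ 0 ∨ y ≠ 0 ∨ z ≠ 0) :
    ∃ Q : GL (Fin 2) F, !![x, y; z, -x] * Q.val = Q.val * !![0, x ^ 2 + y * z; 1, 0] := by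
  have key : ∀ u v : F, u * (z * u - x * v) - v * (x * u + y * v) ≠ 0 →
      ∃ Q : GL (Fin 2) F, !![x, y; z, -x] * Q.val = Q.val * !![0, x ^ 2 + y * z; 1, 0] := by
    intro u v huv
    refine ⟨Matrix.GeneralLinearGroup.mkOfDetNeZero !![u, x * u + y * v; v, z * u - x * v] ?_, ?_⟩
    · rw [Matrix.det_fin_two_of]
      exact fun h => huv (by linear_combination h)
    · simp only [Matrix.GeneralLinearGroup.mkOfDetNeZero, Matrix.GeneralLinearGroup.mk',
        Matrix.unitOfDetInvertible]
      ext i j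
      fin_cases i <;> fin_cases j <;> simp [Matrix.mul_apply, Fin.sum_univ_two] <;> ring
  by_cases hz : z = 0
  · by_cases hy : y = 0
    · subst hz hy
      refine key 1 1 ?_
      have hx : x ≠ 0 := by simpa using h
      intro h0
      exact mul_ne_zero h2 hx (by linear_combination -h0)
    · exact key 0 1 (by simpa using hy)
  · exact key 1 0 (by simpa using hz)

variable {p : ℕ} [Fact p.Prime]

theorem isConjugateSubgroup_of_forall_mem {H T : Subgroup (GL2 (p ^ 2))} (hker : H ≤ (phi p).ker)
    (hcard : Nat.card T ≤ Nat.card H) (P : GL2 p)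
    (h : ∀ A, kerElt A ∈ H → kerElt (P.val * A * P⁻¹.val) ∈ T) : IsConjugateSubgroup H T := by
  obtain ⟨g, rfl⟩ := phi_surjective p P
  refine ⟨g, Subgroup.eq_of_le_of_card_ge ?_ ?_⟩
  · rintro _ ⟨x, hx, rfl⟩
    obtain ⟨A, rfl⟩ := exists_eq_kerElt_of_mem_ker (hker hx)
    change g * kerElt A * g⁻¹ ∈ T
    rw [conj_kerElt]
    exact h A hx
  · rwa [Subgroup.card_map_of_injective (MulAut.conj g).injective]

/-- For a subgroup `H` of order at most `p²`, the traceless matrices `A` with `1 + p A ∈ H` are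
orthogonal, for the trace form, to some nonzero traceless matrix. -/
theorem exists_orthogonal {H : Subgroup (GL2 (p ^ 2))} (hcard : Nat.card H ≤ p ^ 2)
    (h2 : (2 : ZMod p) ≠ 0) :
    ∃ x y z : ZMod p, (x ≠ 0 ∨ y ≠ 0 ∨ z ≠ 0) ∧ ∀ A : Matrix (Fin 2) (Fin 2) (ZMod p),
      A.trace = 0 → kerElt A ∈ H → (!![x, y; z, -x] * A).trace = 0 := by
  let V : AddSubgroup (Fin 3 → ZMod p) :=
    { carrier := {v | kerElt !![v 0, v 1; v 2, -v 0] ∈ H}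
      zero_mem' := by
        have h0 : !![(0 : ZMod p), 0; 0, -0] = 0 := by
          ext i j
          fin_cases i <;> fin_cases j <;> simp
        change kerElt !![(0 : ZMod p), 0; 0, -0] ∈ H
        rw [h0, kerElt_zero]
        exact one_mem H
      add_mem' := by
        intro v w hv hw
        have hadd : !![v 0 + w 0, v 1 + w 1; v 2 + w 2, -(v 0 + w 0)] =
            !![v 0, v 1; v 2, -v 0] + !![w 0, w 1; w 2, -w 0] := by
          ext i j
          fin_cases i <;> fin_cases j <;> simp [add_comm]
        change kerElt !![v 0 + w 0, v 1 + w 1; v 2 + w 2, -(v 0 + w 0)] ∈ H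
        rw [hadd, kerElt_add]
        exact mul_mem hv hw
      neg_mem' := by
        intro v hv
        have hneg : !![-v 0, -v 1; -v 2, - -v 0] = -!![v 0, v 1; v 2, -v 0] := by
          ext i j
          fin_cases i <;> fin_cases j <;> simp
        change kerElt !![-v 0, -v 1; -v 2, - -v 0] ∈ H
        rw [hneg, kerElt_neg]
        exact inv_mem hv }
  let W : Submodule (ZMod p) (Fin 3 → ZMod p) := AddSubgroup.toZModSubmodule p V
  have hW : W < ⊤ := by
    refine lt_top_iff_ne_top.2 fun htop => ?_
    have hmem : ∀ v : Fin 3 → ZMod p, kerElt !![v 0, v 1; v 2, -v 0] ∈ H := fun v =>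
      (htop ▸ Submodule.mem_top : v ∈ W)
    have hinj : Function.Injective fun v : Fin 3 → ZMod p => (⟨_, hmem v⟩ : H) := by
      intro v w hvw
      have hvw' := kerElt_injective (congrArg Subtype.val hvw)
      ext i
      fin_cases i
      · exact congrFun₂ hvw' 0 0
      · exact congrFun₂ hvw' 0 1
      · exact congrFun₂ hvw' 1 0
    have hle := (Nat.card_le_card_of_injective _ hinj).trans hcard
    rw [Nat.card_fun, Nat.card_zmod, Nat.card_fin] at hle
    exact absurd hle (not_le.2 (Nat.pow_lt_pow_right (Fact.out : p.Prime).one_lt (by norm_num)))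
  obtain ⟨f, hf0, hf⟩ := W.exists_le_ker_of_lt_top hW
  have hfv : ∀ v, f v = v 0 * f (Pi.single 0 1) + v 1 * f (Pi.single 1 1)
      + v 2 * f (Pi.single 2 1) := by
    intro v
    rw [LinearMap.pi_apply_eq_sum_univ f v, Fin.sum_univ_three]
    have hsingle : ∀ i : Fin 3, (fun j => if i = j then (1 : ZMod p) else 0) = Pi.single i 1 := by
      intro i
      ext j
      simp [Pi.single_apply, eq_comm]
    simp only [hsingle, smul_eq_mul]
  refine ⟨f (Pi.single 0 1) / 2, f (Pi.single 2 1), f (Pi.single 1 1), ?_, ?_⟩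
  · by_contra! hc
    obtain ⟨h0, h1, h2'⟩ := hc
    have h0' : f (Pi.single 0 1) = 0 := by simpa [h2] using h0
    exact hf0 (LinearMap.ext fun v => by rw [hfv, h0', h1, h2']; simp)
  · intro A hA hAH
    rw [Matrix.trace_fin_two] at hA
    have hAe : A = !![A 0 0, A 0 1; A 1 0, -A 0 0] := by
      rw [← eq_neg_of_add_eq_zero_right hA]
      exact Matrix.eta_fin_two A
    have hmem : (![A 0 0, A 0 1, A 1 0] : Fin 3 → ZMod p) ∈ W := by
      change kerElt _ ∈ H
      rw [hAe] at hAH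
      exact hAH
    have hfA := hfv ![A 0 0, A 0 1, A 1 0]
    rw [LinearMap.mem_ker.1 (hf hmem)] at hfA
    simp at hfA
    rw [hAe]
    simp [Matrix.trace_fin_two]
    field_simp
    linear_combination -2 * hfA

/-- For a subgroup `H` of order at most `p²` in which all determinants are `1`, the matrices `A` with
`1 + p A ∈ H` are, up to a change of basis, orthogonal to a companion matrix for the trace form. -/
theorem exists_conj_le_orthogonal_companion {H : Subgroup (GL2 (p ^ 2))}
    (hdet : ∀ g ∈ H, (g.val : Matrix (Fin 2) (Fin 2) (ZMod (p ^ 2))).det = 1)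
    (hcard : Nat.card H ≤ p ^ 2) (h2 : (2 : ZMod p) ≠ 0) :
    ∃ (Q : GL2 p) (d : ZMod p), ∀ A, kerElt A ∈ H →
      ∃ a c, Q⁻¹.val * A * Q.val = !![a, d * c; c, -a] := by
  obtain ⟨x, y, z, hxyz, horth⟩ := exists_orthogonal hcard h2
  obtain ⟨Q, hQ⟩ := exists_conj_companion h2 hxyz
  refine ⟨Q, -(x ^ 2 + y * z), fun A hA => ?_⟩
  have htr : A.trace = 0 := trace_eq_zero_of_det_kerElt (hdet _ hA)
  have horthA := horth A htr hA
  set Y := Q⁻¹.val * A * Q.val with hY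
  have hYtr : Y.trace = 0 := by
    rw [hY, Matrix.trace_mul_cycle, Units.mul_inv, one_mul, htr]
  have hYorth : (!![0, x ^ 2 + y * z; 1, 0] * Y).trace = 0 := by
    have hC : !![0, x ^ 2 + y * z; 1, 0] = Q⁻¹.val * !![x, y; z, -x] * Q.val := by
      rw [mul_assoc, hQ, Units.inv_mul_cancel_left]
    have hCY : !![0, x ^ 2 + y * z; 1, 0] * Y = Q⁻¹.val * (!![x, y; z, -x] * A) * Q.val := by
      rw [hC, hY]
      simp only [mul_assoc, Units.mul_inv_cancel_left]
    rw [hCY, Matrix.trace_mul_cycle, Units.mul_inv, one_mul, horthA]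
  rw [Matrix.trace_fin_two] at hYtr
  simp only [Matrix.trace_fin_two, Matrix.mul_apply, Fin.sum_univ_two, Matrix.of_apply,
    Matrix.cons_val_zero, Matrix.cons_val_one, Matrix.cons_val', Matrix.cons_val_fin_one] at hYorth
  refine ⟨Y 0 0, Y 1 0, ?_⟩
  ext i j
  fin_cases i <;> fin_cases j <;> simp
  · linear_combination hYorth
  · linear_combination hYtr

theorem isConjugateSubgroup_of_basis_change {H T : Subgroup (GL2 (p ^ 2))}
    (hker : H ≤ (phi p).ker) (hcard : Nat.card T ≤ Nat.card H) (Q D : GL2 p)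
    (h : ∀ A, kerElt A ∈ H → ∃ X, D.val * (Q⁻¹.val * A * Q.val) = X * D.val ∧ kerElt X ∈ T) :
    IsConjugateSubgroup H T := by
  refine isConjugateSubgroup_of_forall_mem hker hcard (D * Q⁻¹) fun A hA => ?_
  obtain ⟨X, hX, hXT⟩ := h A hA
  have hconj : (D * Q⁻¹).val * A * (D * Q⁻¹)⁻¹.val = X := by
    rw [_root_.mul_inv_rev, inv_inv, Units.val_mul, Units.val_mul]
    calc D.val * Q⁻¹.val * A * (Q.val * D⁻¹.val)
        = D.val * (Q⁻¹.val * A * Q.val) * D⁻¹.val := by simp only [mul_assoc]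
      _ = X := by rw [hX, Units.mul_inv_cancel_right]
  rwa [hconj]

theorem exists_eq_mul_sq {e d : ZMod p} (he : ¬ IsSquare e) (hd : d ≠ 0) :
    ∃ s, s ≠ 0 ∧ (d = s ^ 2 ∨ d = e * s ^ 2) := by
  have he0 : e ≠ 0 := fun h => he (h ▸ IsSquare.zero)
  by_cases hsq : IsSquare d
  · obtain ⟨s, rfl⟩ := hsq
    exact ⟨s, left_ne_zero_of_mul hd, Or.inl (pow_two s).symm⟩
  · obtain ⟨s, hs⟩ := isSquare_mul_of_not_isSquare he hsq
    have hs0 : s ≠ 0 := left_ne_zero_of_mul (hs ▸ mul_ne_zero he0 hd)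
    refine ⟨s / e, div_ne_zero hs0 he0, Or.inr ?_⟩
    field_simp
    linear_combination hs

theorem isConjugateSubgroup_T₁_or_T₂_or_T₃ (hp : Odd p) {ε : ZMod (p ^ 2)}
    (hε : ¬ IsSquare (red p ε)) {H : Subgroup (GL2 (p ^ 2))} (hker : H ≤ (phi p).ker)
    (hdet : ∀ g ∈ H, (g.val : Matrix (Fin 2) (Fin 2) (ZMod (p ^ 2))).det = 1)
    (hcard : Nat.card H = p ^ 2) :
    IsConjugateSubgroup H (T₁ p) ∨ IsConjugateSubgroup H (T₂ p) ∨
      IsConjugateSubgroup H (T₃ p ε) := by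
  have h2 : (2 : ZMod p) ≠ 0 := by
    refine Ring.two_ne_zero ?_
    rw [ZMod.ringChar_zmod_n]
    rintro rfl
    exact absurd hp (by decide)
  obtain ⟨Q, d, hQ⟩ := exists_conj_le_orthogonal_companion hdet hcard.le h2
  have hle : ∀ A B : Matrix (Fin 2) (Fin 2) (ZMod (p ^ 2)),
      Nat.card (Subgroup.closure {kerUnit A, kerUnit B}) ≤ Nat.card H := fun A B =>
    (card_closure_kerUnit_pair_le A B).trans hcard.ge
  by_cases hd : d = 0
  · left
    refine isConjugateSubgroup_of_basis_change hker (hle _ _) Q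
      (Matrix.GeneralLinearGroup.mkOfDetNeZero !![0, 1; 1, 0] (by simp)) fun A hA => ?_
    obtain ⟨a, c, hac⟩ := hQ A hA
    refine ⟨!![-a, c; 0, - -a], ?_, mem_T₁.2 ⟨_, _, rfl⟩⟩
    rw [hac, hd]
    simp [Matrix.GeneralLinearGroup.mkOfDetNeZero, Matrix.GeneralLinearGroup.mk',
      Matrix.unitOfDetInvertible]
  · right
    obtain ⟨s, hs, hds⟩ := exists_eq_mul_sq hε hd
    refine hds.imp (fun hds => ?_) fun hds => ?_
    · refine isConjugateSubgroup_of_basis_change hker (hle _ _) Q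
        (Matrix.GeneralLinearGroup.mkOfDetNeZero !![1, 0; 0, s] (by simpa using hs)) fun A hA => ?_
      obtain ⟨a, c, hac⟩ := hQ A hA
      refine ⟨!![a, s * c; s * c, -a], ?_, mem_T₂.2 ⟨_, _, rfl⟩⟩
      rw [hac, hds]
      ext i j
      fin_cases i <;> fin_cases j <;>
        simp [Matrix.GeneralLinearGroup.mkOfDetNeZero, Matrix.GeneralLinearGroup.mk',
          Matrix.unitOfDetInvertible] <;> ring
    · refine isConjugateSubgroup_of_basis_change hker (hle _ _) Q
        (Matrix.GeneralLinearGroup.mkOfDetNeZero !![1, 0; 0, s] (by simpa using hs)) fun A hA => ?_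
      obtain ⟨a, c, hac⟩ := hQ A hA
      refine ⟨!![a, s * c * red p ε; s * c, -a], ?_, mem_T₃.2 ⟨_, _, rfl⟩⟩
      rw [hac, hds]
      ext i j
      fin_cases i <;> fin_cases j <;>
        simp [Matrix.GeneralLinearGroup.mkOfDetNeZero, Matrix.GeneralLinearGroup.mk',
          Matrix.unitOfDetInvertible] <;> ring

end Classification

/-- A subgroup of `ker φ` of order `p²` all of whose elements have
determinant `1` is conjugate in `GL₂(ℤ/p²ℤ)` to one of `T₁, T₂, T₃`, and no two distinct
subgroups among these are locally conjugate in `GL₂(ℤ/p²ℤ)`. -/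
theorem dim_two_subgroups_of_T {p : ℕ} [Fact p.Prime] (hp : Odd p) (ε : ZMod (p^2))
    (hε : ¬ IsSquare (red p ε))
    (H : Subgroup (GL2 (p^2))) (hker : H ≤ (phi p).ker)
    (hdet : ∀ g ∈ H, (↑g : Matrix (Fin 2) (Fin 2) (ZMod (p^2))).det = 1)
    (hcard : Nat.card H = p^2) :
    (IsConjugateSubgroup H (T₁ p) ∨ IsConjugateSubgroup H (T₂ p) ∨
      IsConjugateSubgroup H (T₃ p ε)) ∧
    ¬ IsLocallyConjugate (T₁ p) (T₂ p) ∧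
    ¬ IsLocallyConjugate (T₁ p) (T₃ p ε) ∧
    ¬ IsLocallyConjugate (T₂ p) (T₃ p ε) := by
  exact ⟨isConjugateSubgroup_T₁_or_T₂_or_T₃ hp hε hker hdet hcard, not_isLocallyConjugate_T₁_T₂ hε,
    not_isLocallyConjugate_T₁_T₃ hε, not_isLocallyConjugate_T₂_T₃ hε⟩
end

section
/- Let H₁ and H₂ be subgroups of GL₂(ℤ/p²ℤ) contained in ker φ that are nontrivially locally conjugate in GL₂(ℤ/p²ℤ). Then there exists d ∈ ℤ/p²ℤ whose reduction modulo p is neither 1 nor -1, such that H₁ and H₂ are, in some order, conjugate in GL₂(ℤ/p²ℤ) to the subgroup generated by 1 + p·!![1,0;0,d] and 1 + p·!![0,1;0,0] and to the subgroup generated by 1 + p·!![d,0;0,1] and 1 + p·!![0,1;0,0]. -/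
open Matrix

/-- The subgroup generated by `1 + p•!![1,0;0,d]` and `1 + p•!![0,1;0,0]`. -/
def Kd (p : ℕ) (d : ZMod (p^2)) : Subgroup (GL2 (p^2)) :=
  Subgroup.closure {kerUnit !![1, 0; 0, d], kerUnit !![0, 1; 0, 0]}

/-- The subgroup generated by `1 + p•!![d,0;0,1]` and `1 + p•!![0,1;0,0]`. -/
def Kd' (p : ℕ) (d : ZMod (p^2)) : Subgroup (GL2 (p^2)) :=
  Subgroup.closure {kerUnit !![d, 0; 0, 1], kerUnit !![0, 1; 0, 0]}

namespace MatTwo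

variable {F : Type*} [Field F]

/-- Conjugacy of matrices under the general linear group. -/
def MatConj (A B : Matrix (Fin 2) (Fin 2) F) : Prop :=
  ∃ g : GL (Fin 2) F, (g : Matrix (Fin 2) (Fin 2) F) * A = B * g

/-- Conjugacy of subspaces of matrices under the general linear group. -/
def SubConj (V W : Submodule F (Matrix (Fin 2) (Fin 2) F)) : Prop :=
  ∃ g : GL (Fin 2) F, ∀ A B : Matrix (Fin 2) (Fin 2) F,
    (g : Matrix (Fin 2) (Fin 2) F) * A = B * g → (A ∈ V ↔ B ∈ W)

/-- Local conjugacy of subspaces of matrices under the general linear group. -/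
def LocConj (V W : Submodule F (Matrix (Fin 2) (Fin 2) F)) : Prop :=
  ∃ f : V ≃ W, ∀ A : V, MatConj (A : Matrix (Fin 2) (Fin 2) F) (f A)

theorem inv_mul_eq {g : GL (Fin 2) F} {A B : Matrix (Fin 2) (Fin 2) F}
    (h : (g : Matrix (Fin 2) (Fin 2) F) * A = B * g) :
    ((g⁻¹ : GL (Fin 2) F) : Matrix (Fin 2) (Fin 2) F) * B = A * (g⁻¹ : GL (Fin 2) F) := by
  rw [Units.inv_mul_eq_iff_eq_mul, ← mul_assoc, h, mul_assoc, Units.mul_inv, mul_one]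

theorem MatConj.symm {A B : Matrix (Fin 2) (Fin 2) F} (h : MatConj A B) : MatConj B A := by
  obtain ⟨g, hg⟩ := h
  exact ⟨g⁻¹, inv_mul_eq hg⟩

theorem MatConj.trans {A B C : Matrix (Fin 2) (Fin 2) F} (h : MatConj A B) (h' : MatConj B C) :
    MatConj A C := by
  obtain ⟨g, hg⟩ := h
  obtain ⟨k, hk⟩ := h'
  exact ⟨k * g, by rw [Units.val_mul, mul_assoc, hg, ← mul_assoc, hk, mul_assoc]⟩

theorem MatConj.eq_conj {A B : Matrix (Fin 2) (Fin 2) F} (h : MatConj A B) :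
    ∃ g : GL (Fin 2) F, B = g * A * (g⁻¹ : GL (Fin 2) F) := by
  obtain ⟨g, hg⟩ := h
  exact ⟨g, by rw [hg, mul_assoc, Units.mul_inv, mul_one]⟩

theorem MatConj.trace_eq {A B : Matrix (Fin 2) (Fin 2) F} (h : MatConj A B) :
    A.trace = B.trace := by
  obtain ⟨g, rfl⟩ := h.eq_conj
  rw [trace_mul_comm, ← mul_assoc, Units.inv_mul, one_mul]

theorem MatConj.det_eq {A B : Matrix (Fin 2) (Fin 2) F} (h : MatConj A B) :
    A.det = B.det := by
  obtain ⟨g, rfl⟩ := h.eq_conj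
  rw [det_mul_comm, ← mul_assoc, Units.inv_mul, one_mul]

theorem MatConj.eq_smul_one {A : Matrix (Fin 2) (Fin 2) F} {c : F}
    (h : MatConj A (c • (1 : Matrix (Fin 2) (Fin 2) F))) : A = c • 1 := by
  obtain ⟨g, hg⟩ := h.symm.eq_conj
  simpa using hg

theorem matConj_of_mul_eq {A B g : Matrix (Fin 2) (Fin 2) F} (hg : g.det ≠ 0)
    (h : g * A = B * g) : MatConj A B :=
  ⟨GeneralLinearGroup.mkOfDetNeZero g hg, h⟩

theorem SubConj.refl (V : Submodule F (Matrix (Fin 2) (Fin 2) F)) : SubConj V V :=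
  ⟨1, fun A B h => by simp_all⟩

theorem SubConj.symm {V W : Submodule F (Matrix (Fin 2) (Fin 2) F)} (h : SubConj V W) :
    SubConj W V := by
  obtain ⟨g, hg⟩ := h
  exact ⟨g⁻¹, fun A B hAB => (hg B A (by simpa using inv_mul_eq hAB)).symm⟩

theorem SubConj.trans {V W X : Submodule F (Matrix (Fin 2) (Fin 2) F)} (h : SubConj V W)
    (h' : SubConj W X) : SubConj V X := by
  obtain ⟨g, hg⟩ := h
  obtain ⟨k, hk⟩ := h'
  refine ⟨k * g, fun A B hAB => ?_⟩
  have h₁ : (g : Matrix (Fin 2) (Fin 2) F) * A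
      = (g * A * (g⁻¹ : GL (Fin 2) F)) * g := by
    rw [mul_assoc, Units.inv_mul, mul_one]
  refine (hg _ _ h₁).trans (hk _ _ ?_)
  rw [← mul_assoc, ← mul_assoc, ← Units.val_mul, hAB, Units.val_mul, mul_assoc, mul_assoc,
    Units.mul_inv, mul_one]

theorem LocConj.symm {V W : Submodule F (Matrix (Fin 2) (Fin 2) F)} (h : LocConj V W) :
    LocConj W V := by
  obtain ⟨f, hf⟩ := h
  exact ⟨f.symm, fun A => by simpa using (hf (f.symm A)).symm⟩

theorem LocConj.trans {V W X : Submodule F (Matrix (Fin 2) (Fin 2) F)} (h : LocConj V W)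
    (h' : LocConj W X) : LocConj V X := by
  obtain ⟨f, hf⟩ := h
  obtain ⟨k, hk⟩ := h'
  exact ⟨f.trans k, fun A => (hf A).trans (hk (f A))⟩

theorem LocConj.finrank_eq [Finite F] {V W : Submodule F (Matrix (Fin 2) (Fin 2) F)}
    (h : LocConj V W) : Module.finrank F V = Module.finrank F W := by
  obtain ⟨f, -⟩ := h
  have := Nat.card_congr f
  rw [Module.natCard_eq_pow_finrank (K := F) (V := V),
    Module.natCard_eq_pow_finrank (K := F) (V := W)] at this
  exact Nat.pow_right_injective Finite.one_lt_card this

theorem LocConj.exists_mem {V W : Submodule F (Matrix (Fin 2) (Fin 2) F)} (h : LocConj V W)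
    {A : Matrix (Fin 2) (Fin 2) F} (hA : A ∈ V) : ∃ B ∈ W, MatConj A B := by
  obtain ⟨f, hf⟩ := h
  exact ⟨f ⟨A, hA⟩, (f ⟨A, hA⟩).2, hf ⟨A, hA⟩⟩

/-- Conjugation by an invertible matrix as a linear automorphism. -/
def conjEquiv (g : GL (Fin 2) F) :
    Matrix (Fin 2) (Fin 2) F ≃ₗ[F] Matrix (Fin 2) (Fin 2) F where
  toFun A := g * A * (g⁻¹ : GL (Fin 2) F)
  invFun A := (g⁻¹ : GL (Fin 2) F) * A * g
  map_add' A B := by rw [mul_add, add_mul]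
  map_smul' c A := by simp
  left_inv A := by simp only [← mul_assoc, Units.inv_mul, one_mul]; simp [mul_assoc]
  right_inv A := by simp only [← mul_assoc, Units.mul_inv, one_mul]; simp [mul_assoc]

theorem mul_eq_conjEquiv_mul (g : GL (Fin 2) F) (A : Matrix (Fin 2) (Fin 2) F) :
    (g : Matrix (Fin 2) (Fin 2) F) * A = conjEquiv g A * g := by
  change _ = (g * A * (g⁻¹ : GL (Fin 2) F)) * (g : Matrix (Fin 2) (Fin 2) F)
  rw [mul_assoc (_ * A), Units.inv_mul, mul_one]

theorem mul_eq_iff (g : GL (Fin 2) F) (A B : Matrix (Fin 2) (Fin 2) F) :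
    (g : Matrix (Fin 2) (Fin 2) F) * A = B * g ↔ conjEquiv g A = B := by
  rw [mul_eq_conjEquiv_mul, Units.mul_left_inj]

theorem subConj_map (g : GL (Fin 2) F) (V : Submodule F (Matrix (Fin 2) (Fin 2) F)) :
    SubConj V (V.map (conjEquiv g).toLinearMap) := by
  refine ⟨g, fun A B h => ?_⟩
  obtain rfl := (mul_eq_iff g A B).1 h
  simp

theorem SubConj.eq_map {V W : Submodule F (Matrix (Fin 2) (Fin 2) F)} (h : SubConj V W) :
    ∃ g : GL (Fin 2) F, W = V.map (conjEquiv g).toLinearMap := by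
  obtain ⟨g, hg⟩ := h
  refine ⟨g, ?_⟩
  ext B
  have := hg ((conjEquiv g).symm B) B ((mul_eq_iff _ _ _).2 (by simp))
  rw [← this]
  simp [Submodule.mem_map_equiv]

theorem SubConj.locConj {V W : Submodule F (Matrix (Fin 2) (Fin 2) F)} (h : SubConj V W) :
    LocConj V W := by
  obtain ⟨g, rfl⟩ := h.eq_map
  exact ⟨((conjEquiv g).submoduleMap V).toEquiv, fun A => ⟨g, mul_eq_conjEquiv_mul g A⟩⟩

theorem subConj_of_forall_exists {V W : Submodule F (Matrix (Fin 2) (Fin 2) F)}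
    (hVW : Module.finrank F V = Module.finrank F W) {g : Matrix (Fin 2) (Fin 2) F}
    (hg : g.det ≠ 0) (h : ∀ A ∈ V, ∃ B ∈ W, g * A = B * g) : SubConj V W := by
  let G : GL (Fin 2) F := GeneralLinearGroup.mkOfDetNeZero g hg
  have hle : V.map (conjEquiv G).toLinearMap ≤ W := by
    rintro _ ⟨A, hA, rfl⟩
    obtain ⟨B, hB, hAB⟩ := h A hA
    have : conjEquiv G A = B := (mul_eq_iff G A B).1 hAB
    simpa [this] using hB
  have := Submodule.eq_of_le_of_finrank_eq hle (((conjEquiv G).finrank_map_eq V).trans hVW)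
  rw [← this]
  exact subConj_map G V

/-- The trace form on two by two matrices. -/
def traceForm (F : Type*) [Field F] : LinearMap.BilinForm F (Matrix (Fin 2) (Fin 2) F) :=
  LinearMap.mk₂ F (fun A B => (A * B).trace) (by simp [add_mul]) (by simp) (by simp [mul_add])
    (by simp)

theorem traceForm_apply (A B : Matrix (Fin 2) (Fin 2) F) :
    traceForm F A B = (A * B).trace := rfl

theorem traceForm_isSymm : (traceForm F).IsSymm :=
  ⟨fun A B => trace_mul_comm A B⟩

theorem traceForm_nondegenerate : (traceForm F).Nondegenerate := by
  refine (LinearMap.IsRefl.nondegenerate_iff_separatingLeft (B := traceForm F)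
    (LinearMap.BilinForm.IsSymm.isRefl traceForm_isSymm)).2 ?_
  intro A hA
  exact ext_iff_trace_mul_right.2 fun B => by simpa [traceForm_apply] using hA B

/-- The orthogonal complement with respect to the trace form. -/
abbrev perp (V : Submodule F (Matrix (Fin 2) (Fin 2) F)) :
    Submodule F (Matrix (Fin 2) (Fin 2) F) :=
  (traceForm F).orthogonal V

theorem mem_perp {V : Submodule F (Matrix (Fin 2) (Fin 2) F)} {B : Matrix (Fin 2) (Fin 2) F} :
    B ∈ perp V ↔ ∀ A ∈ V, (A * B).trace = 0 := Iff.rfl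

theorem perp_perp (V : Submodule F (Matrix (Fin 2) (Fin 2) F)) : perp (perp V) = V :=
  LinearMap.BilinForm.orthogonal_orthogonal traceForm_nondegenerate traceForm_isSymm.isRefl V

theorem finrank_perp (V : Submodule F (Matrix (Fin 2) (Fin 2) F)) :
    Module.finrank F (perp V) = 4 - Module.finrank F V := by
  rw [LinearMap.BilinForm.finrank_orthogonal traceForm_nondegenerate]
  simp [Module.finrank_matrix]

theorem trace_mul_of_mul_eq {g : GL (Fin 2) F} {A A' B B' : Matrix (Fin 2) (Fin 2) F}
    (hA : (g : Matrix (Fin 2) (Fin 2) F) * A = A' * g)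
    (hB : (g : Matrix (Fin 2) (Fin 2) F) * B = B' * g) :
    (A * B).trace = (A' * B').trace :=
  MatConj.trace_eq ⟨g, by rw [← mul_assoc, hA, mul_assoc, hB, mul_assoc]⟩

theorem SubConj.perp {V W : Submodule F (Matrix (Fin 2) (Fin 2) F)} (h : SubConj V W) :
    SubConj (perp V) (perp W) := by
  obtain ⟨g, hg⟩ := h
  refine ⟨g, fun A B hAB => ?_⟩
  rw [mem_perp, mem_perp]
  constructor
  · intro hA C hC
    have hC' := (mul_eq_iff g ((conjEquiv g).symm C) C).2 (by simp)
    rw [← trace_mul_of_mul_eq hC' hAB]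
    exact hA _ ((hg _ _ hC').2 hC)
  · intro hB C hC
    rw [trace_mul_of_mul_eq (mul_eq_conjEquiv_mul g C) hAB]
    exact hB _ ((hg _ _ (mul_eq_conjEquiv_mul g C)).1 hC)

open Classical in
theorem sum_addChar_trace_eq [Fintype F] (V : Submodule F (Matrix (Fin 2) (Fin 2) F))
    {ψ : AddChar F ℂ} (hψ : ψ ≠ 0) (B : Matrix (Fin 2) (Fin 2) F) :
    ∑ A : V, ψ ((A : Matrix (Fin 2) (Fin 2) F) * B).trace
      = if B ∈ perp V then (Fintype.card V : ℂ) else 0 := by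
  let χ : V →+ F :=
    { toFun := fun A => ((A : Matrix (Fin 2) (Fin 2) F) * B).trace
      map_zero' := by simp
      map_add' := by simp [add_mul] }
  have hχ : ψ.compAddMonoidHom χ = 0 ↔ B ∈ perp V := by
    rw [mem_perp]
    constructor
    · intro h A hA
      by_contra hne
      apply hψ
      ext x
      have := DFunLike.congr_fun h ((x / (A * B).trace) • ⟨A, hA⟩ : V)
      simpa [χ, hne] using this
    · intro h
      ext A
      simp [χ, h A A.2]
  have := AddChar.sum_eq_ite (ψ.compAddMonoidHom χ)
  simp only [hχ] at this
  exact this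

/-- Local conjugacy passes to orthogonal complements, by Fourier inversion. -/
theorem LocConj.exists_mem_perp [Finite F] {V W : Submodule F (Matrix (Fin 2) (Fin 2) F)}
    (h : LocConj V W) {B : Matrix (Fin 2) (Fin 2) F} (hB : B ∈ perp V) :
    ∃ C ∈ perp W, MatConj B C := by
  classical
  have := Fintype.ofFinite F
  obtain ⟨f, hf⟩ := h
  obtain ⟨ψ, hψ'⟩ := AddChar.exists_apply_ne_zero.2 (one_ne_zero : (1 : F) ≠ 0)
  have hψ : ψ ≠ 0 := by
    rintro rfl
    simp at hψ'
  let c : Finset (Matrix (Fin 2) (Fin 2) F) := Finset.univ.filter (MatConj B)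
  have key (U : Submodule F (Matrix (Fin 2) (Fin 2) F)) :
      ∑ A : U, ∑ C ∈ c, ψ ((A : Matrix (Fin 2) (Fin 2) F) * C).trace
        = (c.filter (· ∈ perp U)).card * (Fintype.card U : ℂ) := by
    rw [Finset.sum_comm]
    simp only [sum_addChar_trace_eq U hψ]
    rw [← Finset.sum_filter, Finset.sum_const, nsmul_eq_mul]
  have hsum : ∑ A : V, ∑ C ∈ c, ψ ((A : Matrix (Fin 2) (Fin 2) F) * C).trace
      = ∑ A : W, ∑ C ∈ c, ψ ((A : Matrix (Fin 2) (Fin 2) F) * C).trace := by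
    rw [← f.sum_comp]
    refine Finset.sum_congr rfl fun A _ => ?_
    obtain ⟨g, hg⟩ := hf A
    refine Finset.sum_equiv (conjEquiv g).toEquiv (fun C => ?_) (fun C _ => ?_)
    · simp only [c, Finset.mem_filter, Finset.mem_univ, true_and]
      exact ⟨fun h => h.trans ⟨g, mul_eq_conjEquiv_mul g C⟩,
        fun h => h.trans (MatConj.symm ⟨g, mul_eq_conjEquiv_mul g C⟩)⟩
    · rw [trace_mul_of_mul_eq hg (mul_eq_conjEquiv_mul g C)]
      rfl
  rw [key, key] at hsum
  have hV : ((c.filter (· ∈ perp V)).card * (Fintype.card V : ℂ)) ≠ 0 := by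
    refine mul_ne_zero (Nat.cast_ne_zero.2 (Finset.card_ne_zero_of_mem (a := B) ?_))
      (Nat.cast_ne_zero.2 Fintype.card_ne_zero)
    simp only [c, Finset.mem_filter, Finset.mem_univ, true_and]
    exact ⟨⟨1, by simp⟩, hB⟩
  rw [hsum] at hV
  have hne : (c.filter (· ∈ perp W)).card ≠ 0 := by
    intro h0
    rw [h0] at hV
    simp at hV
  obtain ⟨C, hC⟩ := Finset.card_pos.1 (Nat.pos_of_ne_zero hne)
  simp only [c, Finset.mem_filter, Finset.mem_univ, true_and] at hC
  exact ⟨C, hC.2, hC.1⟩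

/-- The plane of matrices spanned by `!![1,0;0,d]` and `!![0,1;0,0]`. -/
def plane (d : F) : Submodule F (Matrix (Fin 2) (Fin 2) F) :=
  Submodule.span F {!![1, 0; 0, d], !![0, 1; 0, 0]}

/-- The plane of matrices spanned by `!![d,0;0,1]` and `!![0,1;0,0]`. -/
def plane' (d : F) : Submodule F (Matrix (Fin 2) (Fin 2) F) :=
  Submodule.span F {!![d, 0; 0, 1], !![0, 1; 0, 0]}

/-- A pair of subspaces that is conjugate, in some order, to `plane d` and `plane' d` with
`d` different from `1` and `-1`. -/
def IsExceptional (V W : Submodule F (Matrix (Fin 2) (Fin 2) F)) : Prop :=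
  ∃ d : F, d ≠ 1 ∧ d ≠ -1 ∧
    ((SubConj V (plane d) ∧ SubConj W (plane' d)) ∨ (SubConj V (plane' d) ∧ SubConj W (plane d)))

theorem IsExceptional.congr {V W V' W' : Submodule F (Matrix (Fin 2) (Fin 2) F)}
    (h : IsExceptional V W) (hV : SubConj V' V) (hW : SubConj W' W) : IsExceptional V' W' := by
  obtain ⟨d, h1, h2, ⟨h3, h4⟩ | ⟨h3, h4⟩⟩ := h
  · exact ⟨d, h1, h2, .inl ⟨hV.trans h3, hW.trans h4⟩⟩
  · exact ⟨d, h1, h2, .inr ⟨hV.trans h3, hW.trans h4⟩⟩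

theorem subConj_of_finrank_eq_one {V W : Submodule F (Matrix (Fin 2) (Fin 2) F)}
    (hV : Module.finrank F V = 1) (hW : Module.finrank F W = 1)
    (h : ∀ A ∈ V, ∃ B ∈ W, MatConj A B) : SubConj V W := by
  obtain ⟨⟨A, hA⟩, -, hspan⟩ := finrank_eq_one_iff'.1 hV
  obtain ⟨B, hB, g, hg⟩ := h A hA
  refine subConj_of_forall_exists (hV.trans hW.symm) (g := g)
    ((isUnit_iff_isUnit_det _).1 g.isUnit).ne_zero fun C hC => ?_
  obtain ⟨c, hc⟩ := hspan ⟨C, hC⟩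
  obtain rfl : c • A = C := congrArg Subtype.val hc
  exact ⟨c • B, W.smul_mem c hB, by rw [mul_smul_comm, hg, smul_mul_assoc]⟩

theorem eq_span_pair {V : Submodule F (Matrix (Fin 2) (Fin 2) F)}
    (hV : Module.finrank F V = 2) {A B : Matrix (Fin 2) (Fin 2) F} (hA : A ∈ V) (hB : B ∈ V)
    (hA0 : A ≠ 0) (hAB : ∀ c : F, c • A ≠ B) : V = Submodule.span F {A, B} := by
  have hli := (LinearIndependent.pair_iff' hA0).2 hAB
  have hfr := finrank_span_eq_card hli
  rw [Matrix.range_cons, Matrix.range_cons, Matrix.range_empty, Set.union_empty,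
    Set.singleton_union, Fintype.card_fin] at hfr
  refine (Submodule.eq_of_le_of_finrank_eq ?_ (hfr.trans hV.symm)).symm
  rw [Submodule.span_le]
  rintro _ (rfl | rfl)
  exacts [hA, hB]

theorem subConj_of_one_mem {V W : Submodule F (Matrix (Fin 2) (Fin 2) F)}
    (hV : Module.finrank F V = 2) (hW : Module.finrank F W = 2)
    (h : ∀ A ∈ V, ∃ B ∈ W, MatConj A B) (h1 : 1 ∈ V) : SubConj V W := by
  have h1W : (1 : Matrix (Fin 2) (Fin 2) F) ∈ W := by
    obtain ⟨B, hB, hconj⟩ := h 1 h1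
    have : B = (1 : F) • 1 := MatConj.eq_smul_one (by rw [one_smul]; exact hconj.symm)
    rwa [this, one_smul] at hB
  obtain ⟨A, hA, hA1⟩ : ∃ A ∈ V, ∀ c : F, c • (1 : Matrix (Fin 2) (Fin 2) F) ≠ A := by
    by_contra! hcon
    have hle : Module.finrank F V ≤ 1 :=
      finrank_le_one (⟨1, h1⟩ : V) fun w => by
        obtain ⟨c, hc⟩ := hcon w w.2
        exact ⟨c, Subtype.ext hc⟩
    omega
  obtain ⟨B, hB, g, hg⟩ := h A hA
  refine subConj_of_forall_exists (hV.trans hW.symm) (g := g)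
    ((isUnit_iff_isUnit_det _).1 g.isUnit).ne_zero fun C hC => ?_
  rw [eq_span_pair hV h1 hA one_ne_zero hA1] at hC
  obtain ⟨x, y, rfl⟩ := Submodule.mem_span_pair.1 hC
  refine ⟨x • 1 + y • B, W.add_mem (W.smul_mem x h1W) (W.smul_mem y hB), ?_⟩
  rw [mul_add, add_mul, mul_smul_comm, mul_smul_comm, hg]
  simp

theorem subConj_of_perp {V W : Submodule F (Matrix (Fin 2) (Fin 2) F)}
    (h : SubConj (perp V) (perp W)) : SubConj V W := by
  simpa only [perp_perp] using h.perp

theorem matConj_companion (h2 : (2 : F) ≠ 0) {u : Matrix (Fin 2) (Fin 2) F} (hu : u ≠ 0)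
    (htr : u.trace = 0) : ∃ e : F, MatConj u !![0, 1; e, 0] := by
  obtain ⟨a, b, c, d, rfl⟩ : ∃ a b c d, u = !![a, b; c, d] :=
    ⟨_, _, _, _, eta_fin_two u⟩
  obtain rfl : d = -a := by
    simp only [trace_fin_two_of] at htr
    linear_combination htr
  refine ⟨a * a + b * c, ?_⟩
  by_cases hb : b = 0
  · by_cases hc : c = 0
    · subst hb hc
      have ha : a ≠ 0 := by
        rintro rfl
        apply hu
        ext i j
        fin_cases i <;> fin_cases j <;> simp
      refine matConj_of_mul_eq (g := !![1, 1; a, -a]) ?_ ?_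
      · rw [det_fin_two_of]
        have := mul_ne_zero h2 ha
        contrapose! this
        linear_combination -this
      · simp
    · refine matConj_of_mul_eq (g := !![0, 1; c, -a]) ?_ ?_
      · simpa [det_fin_two_of] using hc
      · ext i j
        fin_cases i <;> fin_cases j <;> simp <;> ring
  · refine matConj_of_mul_eq (g := !![1, 0; a, b]) ?_ ?_
    · simpa [det_fin_two_of] using hb
    · ext i j
      fin_cases i <;> fin_cases j <;> simp
      ring

/-- Local conjugacy of two planes sharing a traceless matrix matches up the determinants of
their matrices of trace two. -/
theorem LocConj.exists_injective (h2 : (2 : F) ≠ 0) {u v w : Matrix (Fin 2) (Fin 2) F}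
    (hu : u.trace = 0) (hv : v.trace = 2) (hw : w.trace = 2) (hu0 : u ≠ 0)
    (h : LocConj (Submodule.span F {u, v}) (Submodule.span F {u, w})) :
    ∃ σ : F → F, Function.Injective σ ∧ ∀ x, (x • u + v).det = (σ x • u + w).det := by
  obtain ⟨f, hf⟩ := h
  have hmem (x : F) : x • u + v ∈ Submodule.span F {u, v} :=
    Submodule.mem_span_pair.2 ⟨x, 1, by simp⟩
  have hex (x : F) : ∃ y : F, (f ⟨_, hmem x⟩ : Matrix (Fin 2) (Fin 2) F) = y • u + w := by
    obtain ⟨y, z, hyz⟩ := Submodule.mem_span_pair.1 (f ⟨_, hmem x⟩).2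
    have htr := (hf ⟨_, hmem x⟩).trace_eq
    simp only [← hyz, trace_add, trace_smul, hu, hv, hw, smul_eq_mul] at htr
    have hz : z = 1 := mul_right_cancel₀ h2 (by linear_combination -htr)
    exact ⟨y, by rw [← hyz, hz, one_smul]⟩
  choose σ hσ using hex
  refine ⟨σ, fun x y hxy => ?_, fun x => ?_⟩
  · have h1 : f ⟨_, hmem x⟩ = f ⟨_, hmem y⟩ := Subtype.ext (by rw [hσ, hσ, hxy])
    have h3 := congrArg Subtype.val (f.injective h1)
    have h4 : x • u = y • u := add_right_cancel h3
    exact smul_left_injective F hu0 h4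
  · rw [← hσ]
    exact (hf ⟨_, hmem x⟩).det_eq

theorem subConj_span_pair {u v w g : Matrix (Fin 2) (Fin 2) F}
    (hfr : Module.finrank F (Submodule.span F {u, v}) = Module.finrank F (Submodule.span F {u, w}))
    (hg : g.det ≠ 0) {r s : F} (hu : g * u = (r • u) * g) (hv : g * v = (s • u + w) * g) :
    SubConj (Submodule.span F {u, v}) (Submodule.span F {u, w}) := by
  refine subConj_of_forall_exists hfr hg fun C hC => ?_
  obtain ⟨x, y, rfl⟩ := Submodule.mem_span_pair.1 hC
  refine ⟨(x * r + y * s) • u + y • w, Submodule.mem_span_pair.2 ⟨_, _, rfl⟩, ?_⟩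
  rw [mul_add, mul_smul_comm, mul_smul_comm, hu, hv]
  simp only [add_mul, smul_mul_assoc, smul_add, add_smul, mul_smul]
  abel

theorem subConj_of_semisimple [Finite F] (h2 : (2 : F) ≠ 0) {e a b a' b' : F} (he : e ≠ 0)
    (h : LocConj (Submodule.span F {!![0, 1; e, 0], !![1 + a, b; -e * b, 1 - a]})
      (Submodule.span F {!![0, 1; e, 0], !![1 + a', b'; -e * b', 1 - a']}))
    (hab : a ≠ 0 ∨ b ≠ 0) (hab' : a' ≠ 0 ∨ b' ≠ 0) :
    SubConj (Submodule.span F {!![0, 1; e, 0], !![1 + a, b; -e * b, 1 - a]})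
      (Submodule.span F {!![0, 1; e, 0], !![1 + a', b'; -e * b', 1 - a']}) := by
  have hfr := h.finrank_eq
  obtain ⟨σ, hσ, hdet⟩ := h.exists_injective h2 (by simp [trace_fin_two_of])
    (by rw [trace_fin_two_of]; ring) (by rw [trace_fin_two_of]; ring)
    (fun h0 => by simpa using congrFun (congrFun h0 0) 1)
  have hq (x : F) : a' ^ 2 - e * b' ^ 2 + e * σ x ^ 2 = a ^ 2 - e * b ^ 2 + e * x ^ 2 := by
    have := hdet x
    simp only [smul_of, smul_cons, smul_empty, smul_eq_mul, of_add_of, add_cons, empty_add_empty,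
      head_cons, tail_cons, det_fin_two_of] at this
    linear_combination this
  have hnorm : a' ^ 2 - e * b' ^ 2 = a ^ 2 - e * b ^ 2 := by
    obtain ⟨y, hy⟩ := (Finite.injective_iff_surjective.1 hσ) (-σ 0)
    have h0 := hq 0
    have h3 := hq y
    rw [hy] at h3
    have hy0 : y = 0 := by
      have : e * y ^ 2 = 0 := by linear_combination h0 - h3
      simpa [he] using this
    rw [hy0] at hy
    have hσ0 : σ 0 = 0 := by
      have : 2 * σ 0 = 0 := by linear_combination hy
      simpa [h2] using this
    rw [hσ0] at h0
    linear_combination h0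
  by_cases hsum : (a + a') ^ 2 - e * (b + b') ^ 2 = 0
  · by_cases hdiff : (a - a') ^ 2 - e * (b - b') ^ 2 = 0
    · have hz : a ^ 2 - e * b ^ 2 = 0 := by
        have : (2 * 2) * (a ^ 2 - e * b ^ 2) = 0 := by
          linear_combination hsum + hdiff - 2 * hnorm
        simpa [h2] using this
      have hz' : a' ^ 2 - e * b' ^ 2 = 0 := hnorm.trans hz
      have hm : a * a' - e * b * b' = 0 := by
        have : (2 * 2) * (a * a' - e * b * b') = 0 := by
          linear_combination hsum - hdiff
        simpa [h2] using this
      have ha : a ≠ 0 := by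
        rintro rfl
        have : b = 0 := by simpa [he] using hz
        simp [this] at hab
      have ha' : a' ≠ 0 := by
        rintro rfl
        have : b' = 0 := by simpa [he] using hz'
        simp [this] at hab'
      have hc : a' * b = a * b' := by
        refine mul_left_cancel₀ ha ?_
        linear_combination b * hm - b' * hz
      refine subConj_span_pair (g := !![-a * (a' + a), (a' - a) * b;
        (a' - a) * b * e, -a * (a' + a)]) hfr ?_ (r := 1) (s := 0) ?_ ?_
      · rw [det_fin_two_of]
        have : (2 * 2) * (a ^ 2 * (a * a')) ≠ 0 := by simp [ha, ha', h2]
        contrapose! this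
        linear_combination this - (a' - a) ^ 2 * hz
      · simp only [one_smul, mul_fin_two]
        congr! 1
        ext i j
        fin_cases i <;> fin_cases j <;> simp <;> ring
      · simp only [zero_smul, zero_add, mul_fin_two]
        ext i j
        fin_cases i <;> fin_cases j <;> simp <;> grind
    · refine subConj_span_pair (g := !![0, 1; e, 0] * !![a - a', b - b'; -e * (b - b'), a' - a])
        hfr ?_ (r := -1) (s := 0) ?_ ?_
      · rw [det_mul, det_fin_two_of, det_fin_two_of]
        contrapose! hdiff
        refine mul_left_cancel₀ he ?_
        linear_combination hdiff
      · simp only [mul_fin_two]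
        ext i j
        fin_cases i <;> fin_cases j <;> simp <;> ring
      · simp only [zero_smul, zero_add, mul_fin_two]
        ext i j
        fin_cases i <;> fin_cases j <;> simp <;> grind
  · refine subConj_span_pair (g := !![a + a', b + b'; -e * (b + b'), -(a + a')])
      hfr ?_ (r := -1) (s := 0) ?_ ?_
    · rw [det_fin_two_of]
      contrapose! hsum
      linear_combination -hsum
    · simp only [mul_fin_two]
      ext i j
      fin_cases i <;> fin_cases j <;> simp <;> ring
    · simp only [zero_smul, zero_add, mul_fin_two]
      ext i j
      fin_cases i <;> fin_cases j <;> simp <;> grind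

theorem span_upper_eq_plane {a : F} (ha : 1 + a ≠ 0) :
    Submodule.span F {!![0, 1; 0, 0], !![1 + a, 0; 0, 1 - a]} = plane ((1 - a) / (1 + a)) := by
  rw [plane, Set.pair_comm, Submodule.span_insert, Submodule.span_insert,
    ← Submodule.span_singleton_smul_eq (IsUnit.mk0 _ ha) !![1, 0; 0, (1 - a) / (1 + a)]]
  congr! 3
  ext i j
  fin_cases i <;> fin_cases j <;> simp [mul_div_cancel₀, ha]

theorem span_upper_eq_plane' {a : F} (ha : 1 + a ≠ 0) :
    Submodule.span F {!![0, 1; 0, 0], !![1 - a, 0; 0, 1 + a]} = plane' ((1 - a) / (1 + a)) := by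
  rw [plane', Set.pair_comm, Submodule.span_insert, Submodule.span_insert,
    ← Submodule.span_singleton_smul_eq (IsUnit.mk0 _ ha) !![(1 - a) / (1 + a), 0; 0, 1]]
  congr! 3
  ext i j
  fin_cases i <;> fin_cases j <;> simp [mul_div_cancel₀, ha]

theorem subConj_or_isExceptional_of_nilpotent [Finite F] (h2 : (2 : F) ≠ 0) {a c a' c' : F}
    (h : LocConj (Submodule.span F {!![0, 1; 0, 0], !![1 + a, 0; c, 1 - a]})
      (Submodule.span F {!![0, 1; 0, 0], !![1 + a', 0; c', 1 - a']})) :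
    SubConj (Submodule.span F {!![0, 1; 0, 0], !![1 + a, 0; c, 1 - a]})
      (Submodule.span F {!![0, 1; 0, 0], !![1 + a', 0; c', 1 - a']}) ∨
    IsExceptional (Submodule.span F {!![0, 1; 0, 0], !![1 + a, 0; c, 1 - a]})
      (Submodule.span F {!![0, 1; 0, 0], !![1 + a', 0; c', 1 - a']}) := by
  have hfr := h.finrank_eq
  obtain ⟨σ, hσ, hdet⟩ := h.exists_injective h2 (by simp [trace_fin_two_of])
    (by rw [trace_fin_two_of]; ring) (by rw [trace_fin_two_of]; ring)
    (fun h0 => by simpa using congrFun (congrFun h0 0) 1)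
  have hq (x : F) : a' ^ 2 + c' * σ x = a ^ 2 + c * x := by
    have := hdet x
    simp only [smul_of, smul_cons, smul_empty, smul_eq_mul, of_add_of, add_cons, empty_add_empty,
      head_cons, tail_cons, det_fin_two_of] at this
    linear_combination this
  have hcc : c = 0 ↔ c' = 0 := by
    constructor
    · rintro rfl
      have h0 : c' * (σ 0 - σ 1) = 0 := by linear_combination hq 0 - hq 1
      refine (mul_eq_zero.1 h0).resolve_right fun h3 => ?_
      exact zero_ne_one (hσ (sub_eq_zero.1 h3))
    · rintro rfl
      linear_combination hq 0 - hq 1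
  by_cases hc : c = 0
  · obtain rfl := hcc.1 hc
    subst hc
    have hsq : (a' - a) * (a' + a) = 0 := by linear_combination hq 0
    rcases mul_eq_zero.1 hsq with h3 | h3
    · obtain rfl : a' = a := by linear_combination h3
      exact .inl (.refl _)
    · obtain rfl : a' = -a := by linear_combination h3
      by_cases ha : a = 0
      · subst ha
        rw [neg_zero]
        exact .inl (.refl _)
      rw [← sub_eq_add_neg, sub_neg_eq_add]
      right
      by_cases ha1 : 1 + a = 0
      · obtain rfl : a = -1 := by linear_combination ha1
        have ha2 : 1 + (1 : F) ≠ 0 := by rwa [one_add_one_eq_two]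
        have hd : (1 - 1) / (1 + 1) = (0 : F) := by simp
        refine ⟨0, zero_ne_one, (neg_ne_zero.2 one_ne_zero).symm, .inr ⟨?_, ?_⟩⟩
        · have := span_upper_eq_plane' ha2
          rw [hd] at this
          rw [← this]
          simp only [sub_neg_eq_add, ← sub_eq_add_neg]
          exact .refl _
        · have := span_upper_eq_plane ha2
          rw [hd] at this
          rw [← this]
          simp only [sub_neg_eq_add, ← sub_eq_add_neg]
          exact .refl _
      · refine ⟨(1 - a) / (1 + a), ?_, ?_, .inl ⟨?_, ?_⟩⟩
        · rw [Ne, div_eq_one_iff_eq ha1]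
          intro h4
          apply mul_ne_zero h2 ha
          linear_combination -h4
        · rw [Ne, div_eq_iff ha1]
          intro h4
          apply h2
          linear_combination h4
        · rw [span_upper_eq_plane ha1]
          exact .refl _
        · rw [span_upper_eq_plane' ha1]
          exact .refl _
  · have hc' : c' ≠ 0 := fun h3 => hc (hcc.2 h3)
    left
    refine subConj_span_pair (g := !![c, a' - a; 0, c']) hfr ?_ (r := c / c')
      (s := (a' - a) * (1 - a) / c' - (1 + a') * (a' - a) / c') ?_ ?_
    · simp [det_fin_two_of, hc, hc']
    · ext i j
      fin_cases i <;> fin_cases j <;> simp [hc']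
    · ext i j
      fin_cases i <;> fin_cases j <;> simp <;> field_simp <;> ring

theorem span_pair_smul_add (u v : Matrix (Fin 2) (Fin 2) F) (t : F) :
    Submodule.span F {u, t • u + v} = Submodule.span F {u, v} := by
  apply le_antisymm <;> rw [Submodule.span_le] <;> rintro _ (rfl | rfl)
  · exact Submodule.subset_span (by simp)
  · exact Submodule.mem_span_pair.2 ⟨t, 1, by simp⟩
  · exact Submodule.subset_span (by simp)
  · exact Submodule.mem_span_pair.2 ⟨-t, 1, by simp⟩

theorem exists_span_eq_of_trace_eq_two (h2 : (2 : F) ≠ 0) (e : F)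
    {v : Matrix (Fin 2) (Fin 2) F} (hv : v.trace = 2) :
    (e ≠ 0 → ∃ a b : F, Submodule.span F {!![0, 1; e, 0], v}
      = Submodule.span F {!![0, 1; e, 0], !![1 + a, b; -e * b, 1 - a]}) ∧
    (e = 0 → ∃ a c : F, Submodule.span F {!![0, 1; e, 0], v}
      = Submodule.span F {!![0, 1; 0, 0], !![1 + a, 0; c, 1 - a]}) := by
  obtain ⟨a, b, c, d, rfl⟩ : ∃ a b c d, v = !![a, b; c, d] :=
    ⟨_, _, _, _, eta_fin_two v⟩
  rw [trace_fin_two_of] at hv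
  refine ⟨fun he => ⟨a - 1, b - (c + e * b) / (2 * e), ?_⟩, ?_⟩
  · rw [← span_pair_smul_add _ !![a, b; c, d] (-((c + e * b) / (2 * e)))]
    congr 2
    refine congrArg _ ?_
    ext i j
    fin_cases i <;> fin_cases j <;> simp <;> grind
  · rintro rfl
    refine ⟨a - 1, c, ?_⟩
    rw [← span_pair_smul_add _ !![a, b; c, d] (-b)]
    congr 2
    refine congrArg _ ?_
    ext i j
    fin_cases i <;> fin_cases j <;> simp
    grind

theorem subConj_or_isExceptional_of_mem [Finite F] (h2 : (2 : F) ≠ 0) {e : F}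
    {v w : Matrix (Fin 2) (Fin 2) F} (hv : v.trace = 2) (hw : w.trace = 2)
    (h1v : 1 ∉ Submodule.span F {!![0, 1; e, 0], v})
    (h1w : 1 ∉ Submodule.span F {!![0, 1; e, 0], w})
    (h : LocConj (Submodule.span F {!![0, 1; e, 0], v})
      (Submodule.span F {!![0, 1; e, 0], w})) :
    SubConj (Submodule.span F {!![0, 1; e, 0], v}) (Submodule.span F {!![0, 1; e, 0], w}) ∨
    IsExceptional (Submodule.span F {!![0, 1; e, 0], v})
      (Submodule.span F {!![0, 1; e, 0], w}) := by
  by_cases he : e = 0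
  · obtain ⟨a, c, hac⟩ := (exists_span_eq_of_trace_eq_two h2 e hv).2 he
    obtain ⟨a', c', hac'⟩ := (exists_span_eq_of_trace_eq_two h2 e hw).2 he
    rw [hac, hac'] at h ⊢
    exact subConj_or_isExceptional_of_nilpotent h2 h
  · obtain ⟨a, b, hab⟩ := (exists_span_eq_of_trace_eq_two h2 e hv).1 he
    obtain ⟨a', b', hab'⟩ := (exists_span_eq_of_trace_eq_two h2 e hw).1 he
    rw [hab] at h h1v ⊢
    rw [hab'] at h h1w ⊢
    have key (a b : F)
        (h1 : 1 ∉ Submodule.span F {!![0, 1; e, 0], !![1 + a, b; -e * b, 1 - a]}) :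
        a ≠ 0 ∨ b ≠ 0 := by
      by_contra! h0
      obtain ⟨rfl, rfl⟩ := h0
      exact h1 (Submodule.subset_span (by simp [one_fin_two]))
    exact .inl (subConj_of_semisimple h2 he h (key _ _ h1v) (key _ _ h1w))

theorem LocConj.subConj_or_isExceptional_of_finrank_eq_two [Finite F] (h2 : (2 : F) ≠ 0)
    {V W : Submodule F (Matrix (Fin 2) (Fin 2) F)} (h : LocConj V W)
    (hV : Module.finrank F V = 2) : SubConj V W ∨ IsExceptional V W := by
  have hW : Module.finrank F W = 2 := h.finrank_eq ▸ hV
  by_cases h1V : 1 ∈ V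
  · exact .inl (subConj_of_one_mem hV hW (fun A hA => h.exists_mem hA) h1V)
  by_cases h1W : 1 ∈ W
  · exact .inl (subConj_of_one_mem hW hV (fun A hA => h.symm.exists_mem hA) h1W).symm
  by_cases h1p : 1 ∈ perp V
  · exact .inl (subConj_of_perp (subConj_of_one_mem (by rw [finrank_perp, hV])
      (by rw [finrank_perp, hW]) (fun A hA => h.exists_mem_perp hA) h1p))
  obtain ⟨v, hv, htv⟩ : ∃ v ∈ V, v.trace = 2 := by
    simp only [mem_perp, mul_one, not_forall] at h1p
    obtain ⟨A, hA, hA0⟩ := h1p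
    exact ⟨(2 / A.trace) • A, V.smul_mem _ hA, by
      rw [trace_smul, smul_eq_mul, div_mul_cancel₀ _ hA0]⟩
  obtain ⟨u, hu, htu, hu0⟩ : ∃ u ∈ V, u.trace = 0 ∧ u ≠ 0 := by
    by_contra! hcon
    have hle : Module.finrank F V ≤ 1 :=
      finrank_le_one (⟨v, hv⟩ : V) fun w => by
        refine ⟨(w : Matrix (Fin 2) (Fin 2) F).trace / 2, Subtype.ext ?_⟩
        refine (sub_eq_zero.1 (hcon _ (V.sub_mem (w.2) (V.smul_mem _ hv)) ?_)).symm
        rw [trace_sub, trace_smul, htv, smul_eq_mul, div_mul_cancel₀ _ h2, sub_self]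
    omega
  obtain ⟨e, he⟩ := matConj_companion h2 hu0 htu
  have normal (U : Submodule F (Matrix (Fin 2) (Fin 2) F)) (hU : Module.finrank F U = 2)
      (hVU : LocConj V U) : ∃ U' : Submodule F (Matrix (Fin 2) (Fin 2) F), SubConj U U' ∧
      ∃ w, w.trace = 2 ∧ U' = Submodule.span F {!![0, 1; e, 0], w} := by
    obtain ⟨B, hB, hvB⟩ := hVU.exists_mem hv
    obtain ⟨A, hA, huA⟩ := hVU.exists_mem hu
    obtain ⟨g, hg⟩ := huA.symm.trans he
    refine ⟨_, subConj_map g U, conjEquiv g B, ?_, ?_⟩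
    · rw [← (MatConj.trace_eq ⟨g, mul_eq_conjEquiv_mul g B⟩), ← hvB.trace_eq, htv]
    · refine eq_span_pair ?_ ?_ (Submodule.mem_map_of_mem hB) ?_ ?_
      · exact ((conjEquiv g).finrank_map_eq U).trans hU
      · rw [← (mul_eq_iff g A _).1 hg]
        exact Submodule.mem_map_of_mem hA
      · intro h0
        simpa using congrFun (congrFun h0 0) 1
      · intro c hc
        have := congrArg trace hc
        rw [← (MatConj.trace_eq ⟨g, mul_eq_conjEquiv_mul g B⟩), ← hvB.trace_eq, htv] at this
        simp [trace_fin_two_of] at this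
        exact h2 this.symm
  have one_notMem {U U' : Submodule F (Matrix (Fin 2) (Fin 2) F)} (hUU : SubConj U U')
      (hU : 1 ∉ U) : 1 ∉ U' := by
    obtain ⟨g, hg⟩ := hUU
    rwa [← hg 1 1 (by simp)]
  obtain ⟨V', hVV, v', htv', rfl⟩ := normal V hV (SubConj.refl V).locConj
  obtain ⟨W', hWW, w', htw', rfl⟩ := normal W hW h
  rcases subConj_or_isExceptional_of_mem h2 htv' htw' (one_notMem hVV h1V) (one_notMem hWW h1W)
    (hVV.symm.locConj.trans (h.trans hWW.locConj)) with h3 | h3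
  · exact .inl (hVV.trans (h3.trans hWW.symm))
  · exact .inr (h3.congr hVV hWW)

theorem LocConj.subConj_or_isExceptional [Finite F] (h2 : (2 : F) ≠ 0)
    {V W : Submodule F (Matrix (Fin 2) (Fin 2) F)} (h : LocConj V W) :
    SubConj V W ∨ IsExceptional V W := by
  have hW := h.finrank_eq
  have hfour : Module.finrank F (Matrix (Fin 2) (Fin 2) F) = 4 := by
    simp [Module.finrank_matrix]
  have hle := Submodule.finrank_le V
  rw [hfour] at hle
  generalize hV : Module.finrank F V = n at *
  interval_cases n
  · rw [Submodule.finrank_eq_zero.1 hV, Submodule.finrank_eq_zero.1 hW.symm]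
    exact .inl (.refl _)
  · exact .inl (subConj_of_finrank_eq_one hV hW.symm fun A hA => h.exists_mem hA)
  · exact h.subConj_or_isExceptional_of_finrank_eq_two h2 hV
  · exact .inl (subConj_of_perp (subConj_of_finrank_eq_one (by rw [finrank_perp, hV])
      (by rw [finrank_perp, ← hW]) fun A hA => h.exists_mem_perp hA))
  · rw [Submodule.eq_top_of_finrank_eq (hV.trans hfour.symm),
      Submodule.eq_top_of_finrank_eq (hW.symm.trans hfour.symm)]
    exact .inl (.refl _)

end MatTwo

namespace KerPhi

open MatTwo

variable {p : ℕ}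

theorem val_kerUnit (A : Matrix (Fin 2) (Fin 2) (ZMod (p ^ 2))) :
    (kerUnit A : Matrix (Fin 2) (Fin 2) (ZMod (p ^ 2))) = 1 + (p : ZMod (p ^ 2)) • A := rfl

theorem kerUnit_mul (A B : Matrix (Fin 2) (Fin 2) (ZMod (p ^ 2))) :
    kerUnit A * kerUnit B = kerUnit (A + B) := by
  have h : (p : ZMod (p ^ 2)) * p = 0 := by
    rw [← Nat.cast_mul, ← pow_two, ZMod.natCast_self]
  ext1
  simp [val_kerUnit, add_mul, mul_add, smul_smul, h]
  abel

theorem val_phi (g : GL2 (p ^ 2)) :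
    (phi p g : Matrix (Fin 2) (Fin 2) (ZMod p))
      = (g : Matrix (Fin 2) (Fin 2) (ZMod (p ^ 2))).map (red p) := rfl

theorem red_surjective : Function.Surjective (red p) :=
  ZMod.ringHom_surjective _

theorem exists_map_red_eq (A : Matrix (Fin 2) (Fin 2) (ZMod p)) :
    ∃ B : Matrix (Fin 2) (Fin 2) (ZMod (p ^ 2)), B.map (red p) = A :=
  ⟨A.map (Function.surjInv red_surjective), by
    ext i j
    exact Function.surjInv_eq red_surjective _⟩

variable [Fact p.Prime]

theorem natCast_mul_eq_zero_iff (a : ZMod (p ^ 2)) : (p : ZMod (p ^ 2)) * a = 0 ↔ red p a = 0 := by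
  have hp := (Fact.out : p.Prime).pos
  obtain ⟨n, rfl⟩ := ZMod.natCast_zmod_surjective a
  rw [map_natCast, ← Nat.cast_mul, ZMod.natCast_eq_zero_iff, ZMod.natCast_eq_zero_iff, pow_two,
    Nat.mul_dvd_mul_iff_left hp]

theorem exists_natCast_mul_of_red_eq_zero {a : ZMod (p ^ 2)} (h : red p a = 0) :
    ∃ b, a = (p : ZMod (p ^ 2)) * b := by
  obtain ⟨n, rfl⟩ := ZMod.natCast_zmod_surjective a
  rw [map_natCast, ZMod.natCast_eq_zero_iff] at h
  obtain ⟨m, rfl⟩ := h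
  exact ⟨m, by push_cast; rfl⟩

theorem isUnit_of_red_ne_zero {a : ZMod (p ^ 2)} (h : red p a ≠ 0) : IsUnit a := by
  obtain ⟨n, rfl⟩ := ZMod.natCast_zmod_surjective a
  rw [map_natCast, Ne, ZMod.natCast_eq_zero_iff] at h
  rw [ZMod.isUnit_iff_coprime]
  exact (((Nat.Prime.coprime_iff_not_dvd Fact.out).2 h).pow_left 2).symm

theorem smul_eq_smul_iff (A B : Matrix (Fin 2) (Fin 2) (ZMod (p ^ 2))) :
    (p : ZMod (p ^ 2)) • A = (p : ZMod (p ^ 2)) • B ↔ A.map (red p) = B.map (red p) := by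
  rw [← Matrix.ext_iff, ← Matrix.ext_iff]
  refine forall_congr' fun i => forall_congr' fun j => ?_
  rw [Matrix.smul_apply, Matrix.smul_apply, smul_eq_mul, smul_eq_mul, ← sub_eq_zero, ← mul_sub,
    natCast_mul_eq_zero_iff, map_sub, sub_eq_zero]
  rfl

theorem kerUnit_eq_iff (A B : Matrix (Fin 2) (Fin 2) (ZMod (p ^ 2))) :
    kerUnit A = kerUnit B ↔ A.map (red p) = B.map (red p) := by
  rw [Units.ext_iff, val_kerUnit, val_kerUnit, add_right_inj, smul_eq_smul_iff]

theorem phi_surjective : Function.Surjective (phi p) := by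
  intro g
  obtain ⟨B, hB⟩ := exists_map_red_eq (p := p) g
  have hdet : IsUnit B.det := by
    apply isUnit_of_red_ne_zero
    rw [RingHom.map_det, RingHom.mapMatrix_apply, hB]
    exact ((isUnit_iff_isUnit_det _).1 g.isUnit).ne_zero
  exact ⟨((isUnit_iff_isUnit_det B).2 hdet).unit, Units.ext hB⟩

/-- The element of `ker φ` attached to a matrix modulo `p`. -/
noncomputable def toKer (A : Matrix (Fin 2) (Fin 2) (ZMod p)) : GL2 (p ^ 2) :=
  kerUnit (exists_map_red_eq A).choose

theorem toKer_map_red (A : Matrix (Fin 2) (Fin 2) (ZMod (p ^ 2))) :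
    toKer (A.map (red p)) = kerUnit A :=
  (kerUnit_eq_iff _ _).2 (exists_map_red_eq (A.map (red p))).choose_spec

theorem toKer_injective : Function.Injective (toKer (p := p)) := by
  intro A B h
  obtain ⟨A, rfl⟩ := exists_map_red_eq A
  obtain ⟨B, rfl⟩ := exists_map_red_eq B
  rwa [toKer_map_red, toKer_map_red, kerUnit_eq_iff] at h

theorem toKer_add (A B : Matrix (Fin 2) (Fin 2) (ZMod p)) :
    toKer (A + B) = toKer A * toKer B := by
  obtain ⟨A, rfl⟩ := exists_map_red_eq A
  obtain ⟨B, rfl⟩ := exists_map_red_eq B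
  rw [← Matrix.map_add _ (map_add (red p)), toKer_map_red, toKer_map_red, toKer_map_red,
    kerUnit_mul]

theorem toKer_zero : toKer (0 : Matrix (Fin 2) (Fin 2) (ZMod p)) = 1 := by
  simpa using toKer_add (0 : Matrix (Fin 2) (Fin 2) (ZMod p)) 0

theorem toKer_neg (A : Matrix (Fin 2) (Fin 2) (ZMod p)) : toKer (-A) = (toKer A)⁻¹ := by
  rw [eq_inv_iff_mul_eq_one, ← toKer_add, neg_add_cancel, toKer_zero]

theorem mul_toKer_eq_iff (g : GL2 (p ^ 2)) (A B : Matrix (Fin 2) (Fin 2) (ZMod p)) :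
    g * toKer A = toKer B * g ↔
      (phi p g : Matrix (Fin 2) (Fin 2) (ZMod p)) * A = B * phi p g := by
  obtain ⟨A, rfl⟩ := exists_map_red_eq A
  obtain ⟨B, rfl⟩ := exists_map_red_eq B
  rw [toKer_map_red, toKer_map_red, Units.ext_iff, Units.val_mul, Units.val_mul, val_kerUnit,
    val_kerUnit, mul_add, add_mul, mul_one, one_mul, add_right_inj, mul_smul_comm,
    smul_mul_assoc, smul_eq_smul_iff, Matrix.map_mul, Matrix.map_mul, val_phi]

theorem kerUnit_mem_ker (A : Matrix (Fin 2) (Fin 2) (ZMod (p ^ 2))) :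
    kerUnit A ∈ (phi p).ker := by
  rw [MonoidHom.mem_ker]
  ext i j
  rw [val_phi, val_kerUnit]
  simp [Matrix.one_apply, apply_ite (red p)]

theorem exists_toKer_eq {h : GL2 (p ^ 2)} (hh : h ∈ (phi p).ker) :
    ∃ A : Matrix (Fin 2) (Fin 2) (ZMod p), toKer A = h := by
  have hred (i j : Fin 2) :
      red p ((h : Matrix (Fin 2) (Fin 2) (ZMod (p ^ 2))) i j - (1 : Matrix _ _ _) i j) = 0 := by
    have h1 := congrArg (fun g : GL2 p => (g : Matrix (Fin 2) (Fin 2) (ZMod p)) i j)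
      (MonoidHom.mem_ker.1 hh)
    simp only [val_phi, map_apply, Units.val_one] at h1
    rw [map_sub, h1]
    simp [Matrix.one_apply, apply_ite (red p)]
  choose B hB using fun i j => exists_natCast_mul_of_red_eq_zero (hred i j)
  refine ⟨(of B).map (red p), ?_⟩
  rw [toKer_map_red]
  ext i j
  simp [val_kerUnit, ← hB]

/-- The subspace of matrices modulo `p` attached to a subgroup of `GL₂(ℤ/p²ℤ)`. -/
noncomputable def subspace (H : Subgroup (GL2 (p ^ 2))) :
    Submodule (ZMod p) (Matrix (Fin 2) (Fin 2) (ZMod p)) :=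
  AddSubgroup.toZModSubmodule p
    { carrier := {A | toKer A ∈ H}
      zero_mem' := by simp [toKer_zero]
      add_mem' := fun {A B} hA hB => by simpa [toKer_add] using H.mul_mem hA hB
      neg_mem' := fun {A} hA => by simp_all [toKer_neg] }

theorem mem_subspace {H : Subgroup (GL2 (p ^ 2))} {A : Matrix (Fin 2) (Fin 2) (ZMod p)} :
    A ∈ subspace H ↔ toKer A ∈ H := Iff.rfl

/-- A subgroup of `ker φ` is in bijection with its subspace of matrices. -/
noncomputable def subspaceEquiv {H : Subgroup (GL2 (p ^ 2))} (hH : H ≤ (phi p).ker) :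
    subspace H ≃ H :=
  Equiv.ofBijective (fun A => ⟨toKer A, A.2⟩)
    ⟨fun _ _ h => Subtype.ext (toKer_injective (congrArg Subtype.val h)), fun h => by
      obtain ⟨A, hA⟩ := exists_toKer_eq (hH h.2)
      exact ⟨⟨A, mem_subspace.2 (hA ▸ h.2)⟩, Subtype.ext hA⟩⟩

theorem coe_subspaceEquiv {H : Subgroup (GL2 (p ^ 2))} (hH : H ≤ (phi p).ker) (A : subspace H) :
    (subspaceEquiv hH A : GL2 (p ^ 2)) = toKer A := rfl

theorem locConj_subspace {H₁ H₂ : Subgroup (GL2 (p ^ 2))} (h₁ : H₁ ≤ (phi p).ker)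
    (h₂ : H₂ ≤ (phi p).ker) (h : IsLocallyConjugate H₁ H₂) :
    LocConj (subspace H₁) (subspace H₂) := by
  obtain ⟨f, hf⟩ := h
  refine ⟨(subspaceEquiv h₁).trans (f.trans (subspaceEquiv h₂).symm), fun A => ?_⟩
  obtain ⟨g, hg⟩ := hf (subspaceEquiv h₁ A)
  refine ⟨phi p g, (mul_toKer_eq_iff _ _ _).1 ?_⟩
  rw [← coe_subspaceEquiv h₂, ← coe_subspaceEquiv h₁]
  simpa using hg.eq

theorem isConjugateSubgroup_of_subConj {H₁ H₂ : Subgroup (GL2 (p ^ 2))} (h₁ : H₁ ≤ (phi p).ker)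
    (h₂ : H₂ ≤ (phi p).ker) (h : SubConj (subspace H₁) (subspace H₂)) :
    IsConjugateSubgroup H₁ H₂ := by
  obtain ⟨g', hg⟩ := h
  obtain ⟨g, rfl⟩ := phi_surjective g'
  refine ⟨g, le_antisymm ?_ fun h hh => ?_⟩
  · rintro _ ⟨h, hh, rfl⟩
    obtain ⟨A, rfl⟩ := exists_toKer_eq (h₁ hh)
    have hA := mul_eq_conjEquiv_mul (phi p g) A
    have h3 := (hg _ _ hA).1 hh
    rw [← mul_toKer_eq_iff, ← mul_inv_eq_iff_eq_mul] at hA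
    change g * toKer A * g⁻¹ ∈ H₂
    rw [hA]
    exact h3
  · obtain ⟨B, rfl⟩ := exists_toKer_eq (h₂ hh)
    have hA := (mul_eq_iff (phi p g) ((conjEquiv (phi p g)).symm B) B).2 (by simp)
    have h3 := (hg _ _ hA).2 hh
    rw [← mul_toKer_eq_iff, ← mul_inv_eq_iff_eq_mul] at hA
    exact ⟨_, h3, hA⟩

theorem closure_kerUnit_le_ker (A B : Matrix (Fin 2) (Fin 2) (ZMod (p ^ 2))) :
    Subgroup.closure {kerUnit A, kerUnit B} ≤ (phi p).ker := by
  rw [Subgroup.closure_le]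
  rintro _ (rfl | rfl) <;> exact kerUnit_mem_ker _

theorem subspace_closure (A B : Matrix (Fin 2) (Fin 2) (ZMod (p ^ 2))) :
    subspace (Subgroup.closure {kerUnit A, kerUnit B})
      = Submodule.span (ZMod p) {A.map (red p), B.map (red p)} := by
  apply le_antisymm
  · intro C hC
    have key : ∀ h ∈ Subgroup.closure {kerUnit A, kerUnit B},
        ∃ D ∈ Submodule.span (ZMod p) {A.map (red p), B.map (red p)}, toKer D = h := by
      intro h hh
      induction hh using Subgroup.closure_induction with
      | mem x hx =>
        rcases hx with rfl | rfl
        · exact ⟨_, Submodule.subset_span (by simp), toKer_map_red A⟩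
        · exact ⟨_, Submodule.subset_span (by simp), toKer_map_red B⟩
      | one => exact ⟨0, Submodule.zero_mem _, toKer_zero⟩
      | mul x y _ _ hx hy =>
        obtain ⟨D, hD, rfl⟩ := hx
        obtain ⟨E, hE, rfl⟩ := hy
        exact ⟨D + E, Submodule.add_mem _ hD hE, toKer_add D E⟩
      | inv x _ hx =>
        obtain ⟨D, hD, rfl⟩ := hx
        exact ⟨-D, Submodule.neg_mem _ hD, toKer_neg D⟩
    obtain ⟨D, hD, hDC⟩ := key _ (mem_subspace.1 hC)
    rwa [← toKer_injective hDC]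
  · rw [Submodule.span_le]
    rintro _ (rfl | rfl)
    · exact mem_subspace.2 (toKer_map_red A ▸ Subgroup.subset_closure (by simp))
    · exact mem_subspace.2 (toKer_map_red B ▸ Subgroup.subset_closure (by simp))

theorem subspace_Kd (d : ZMod (p ^ 2)) : subspace (Kd p d) = plane (red p d) := by
  rw [Kd, subspace_closure, plane]
  congr 2
  · ext i j
    fin_cases i <;> fin_cases j <;> simp
  · refine congrArg _ ?_
    ext i j
    fin_cases i <;> fin_cases j <;> simp

theorem subspace_Kd' (d : ZMod (p ^ 2)) : subspace (Kd' p d) = plane' (red p d) := by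
  rw [Kd', subspace_closure, plane']
  congr 2
  · ext i j
    fin_cases i <;> fin_cases j <;> simp
  · refine congrArg _ ?_
    ext i j
    fin_cases i <;> fin_cases j <;> simp

end KerPhi

/-- Nontrivially locally conjugate subgroups of `ker φ` are, in some
order, conjugate in `GL₂(ℤ/p²ℤ)` to `Kd p d` and `Kd' p d` for some `d` whose reduction
mod `p` is neither `1` nor `-1`. -/
theorem nontrivially_locallyConjugate_ker {p : ℕ} [Fact p.Prime] (hp : Odd p)
    (H₁ H₂ : Subgroup (GL2 (p^2))) (h₁ : H₁ ≤ (phi p).ker) (h₂ : H₂ ≤ (phi p).ker)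
    (h : IsNontriviallyLocallyConjugate H₁ H₂) :
    ∃ d : ZMod (p^2), red p d ≠ 1 ∧ red p d ≠ -1 ∧
      ((IsConjugateSubgroup H₁ (Kd p d) ∧ IsConjugateSubgroup H₂ (Kd' p d)) ∨
       (IsConjugateSubgroup H₁ (Kd' p d) ∧ IsConjugateSubgroup H₂ (Kd p d))) := by
  have h2 : (2 : ZMod p) ≠ 0 := by
    have hp2 : p ≠ 2 := hp.ne_two_of_dvd_nat dvd_rfl
    intro h0
    rw [← Nat.cast_ofNat, ZMod.natCast_eq_zero_iff] at h0
    exact hp2 ((Nat.prime_dvd_prime_iff_eq Fact.out Nat.prime_two).1 h0)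
  rcases (KerPhi.locConj_subspace h₁ h₂ h.1).subConj_or_isExceptional h2 with h3 | h3
  · exact absurd (KerPhi.isConjugateSubgroup_of_subConj h₁ h₂ h3) h.2
  obtain ⟨d', hd1, hd2, hd⟩ := h3
  obtain ⟨d, rfl⟩ := KerPhi.red_surjective d'
  have hK : Kd p d ≤ (phi p).ker := KerPhi.closure_kerUnit_le_ker _ _
  have hK' : Kd' p d ≤ (phi p).ker := KerPhi.closure_kerUnit_le_ker _ _
  rw [← KerPhi.subspace_Kd, ← KerPhi.subspace_Kd'] at hd
  exact ⟨d, hd1, hd2, hd.imp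
    (fun h3 => ⟨KerPhi.isConjugateSubgroup_of_subConj h₁ hK h3.1,
      KerPhi.isConjugateSubgroup_of_subConj h₂ hK' h3.2⟩)
    (fun h3 => ⟨KerPhi.isConjugateSubgroup_of_subConj h₁ hK' h3.1,
      KerPhi.isConjugateSubgroup_of_subConj h₂ hK h3.2⟩)⟩
end
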